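/- arXiv:2604.04282 — 8 statements merged into one kernel-verified Lean document; each statement's English description precedes it below -/
import Mathlib

section
/- Let 𝓡 be a finite set of rectangles, 𝓗₁ a finite set of horizontal lines and 𝓥₀ a finite set of vertical lines such that 𝓗₁ ∪ 𝓥₀ stabs 𝓡. Let 𝓗* be a finite set of horizontal lines and 𝓥* a finite set of vertical lines such that 𝓗* ∪ 𝓥* stabs 𝓡, and set k_v = |𝓥*|. Then there exist Γ_v ⊆ Γ(𝓥₀) and 𝓥₁ ⊆ 𝓥₀ satisfying: (i) 2·(|Γ_v| + |𝓥₁|) ≤ 3·k_v; (ii) Γ_v is separated by 𝓥₁; (iii) for each P ∈ Γ_v there exists exactly one line v*_P ∈ 𝓥* with v*_P ⊆ P; and (iv) 𝓡 is stabbed by 𝓗₁ ∪ 𝓥₁ ∪ 𝓗* ∪ {v*_P : P ∈ Γ_v}. -/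
open Set MeasureTheory

noncomputable section

/-- The horizontal line at height `y`. -/
def hline (y : ℝ) : Set (ℝ × ℝ) := {p : ℝ × ℝ | p.2 = y}

/-- The vertical line at abscissa `x`. -/
def vline (x : ℝ) : Set (ℝ × ℝ) := {p : ℝ × ℝ | p.1 = x}

/-- The axis-parallel rectangle `[a,b] × [c,d]`. -/
def rect (a b c d : ℝ) : Set (ℝ × ℝ) := Set.Icc a b ×ˢ Set.Icc c d

/-- A set is a (possibly degenerate) axis-parallel rectangle. -/
def IsRect (R : Set (ℝ × ℝ)) : Prop :=
  ∃ a b c d : ℝ, a ≤ b ∧ c ≤ d ∧ R = rect a b c d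

/-- A line `l` stabs a rectangle `R` if they intersect. -/
def Stabs (l R : Set (ℝ × ℝ)) : Prop := (R ∩ l).Nonempty

/-- A rectangle is stabbed by a set of lines if some line of the set stabs it. -/
def StabbedBy (L : Set (Set (ℝ × ℝ))) (R : Set (ℝ × ℝ)) : Prop :=
  ∃ l ∈ L, Stabs l R

/-- A set of lines stabs a set of rectangles if every rectangle is stabbed. -/
def StabsAll (L Rs : Set (Set (ℝ × ℝ))) : Prop := ∀ R ∈ Rs, StabbedBy L R

/-- All members are horizontal lines. -/
def IsHLineSet (H : Set (Set (ℝ × ℝ))) : Prop := ∀ l ∈ H, ∃ y : ℝ, l = hline y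

/-- All members are vertical lines. -/
def IsVLineSet (V : Set (Set (ℝ × ℝ))) : Prop := ∀ l ∈ V, ∃ x : ℝ, l = vline x

/-- `H'` is nicely positioned w.r.t. `H''`: for each line of `H'` at height `y`
there is a line of `H''` in the strip `ℝ × (y⁻, y]`, where `y⁻` is the largest
height of a line of `H'` below `y` (or `-∞`). -/
def NicelyPositioned (H' H'' : Set (Set (ℝ × ℝ))) : Prop :=
  ∀ y : ℝ, hline y ∈ H' →
    ∃ z : ℝ, hline z ∈ H'' ∧ z ≤ y ∧ ∀ y' : ℝ, hline y' ∈ H' → y' < y → y' < z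

/-- The open vertical strip `(a, b) × ℝ`. -/
def vstrip (a b : ℝ) : Set (ℝ × ℝ) := {p : ℝ × ℝ | a < p.1 ∧ p.1 < b}

/-- The open horizontal strip `ℝ × (a, b)`. -/
def hstrip (a b : ℝ) : Set (ℝ × ℝ) := {p : ℝ × ℝ | a < p.2 ∧ p.2 < b}

def IsVStrip (P : Set (ℝ × ℝ)) : Prop := ∃ a b : ℝ, a < b ∧ P = vstrip a b

def IsHStrip (P : Set (ℝ × ℝ)) : Prop := ∃ a b : ℝ, a < b ∧ P = hstrip a b

/-- The vertical line `l` separates `P` and `P'` (they lie on opposite sides). -/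
def SepByVLine (P P' l : Set (ℝ × ℝ)) : Prop :=
  ∃ x : ℝ, l = vline x ∧
    (((∀ p ∈ P, p.1 < x) ∧ (∀ p ∈ P', x < p.1)) ∨
     ((∀ p ∈ P', p.1 < x) ∧ (∀ p ∈ P, x < p.1)))

/-- The horizontal line `l` separates `P` and `P'`. -/
def SepByHLine (P P' l : Set (ℝ × ℝ)) : Prop :=
  ∃ y : ℝ, l = hline y ∧
    (((∀ p ∈ P, p.2 < y) ∧ (∀ p ∈ P', y < p.2)) ∨
     ((∀ p ∈ P', p.2 < y) ∧ (∀ p ∈ P, y < p.2)))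

/-- A family of vertical strips is separated by a set of vertical lines. -/
def VSeparated (Gam L : Set (Set (ℝ × ℝ))) : Prop :=
  (∀ P ∈ Gam, ∀ P' ∈ Gam, P ≠ P' → ∃ l ∈ L, SepByVLine P P' l) ∧
  (∀ P ∈ Gam, ∀ l ∈ L, P ∩ l = ∅)

/-- A family of horizontal strips is separated by a set of horizontal lines. -/
def HSeparated (Gam L : Set (Set (ℝ × ℝ))) : Prop :=
  (∀ P ∈ Gam, ∀ P' ∈ Gam, P ≠ P' → ∃ l ∈ L, SepByHLine P P' l) ∧
  (∀ P ∈ Gam, ∀ l ∈ L, P ∩ l = ∅)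

/-- `Γ(L)`: the connected components of the complement of the union of the lines of `L`. -/
def components (L : Set (Set (ℝ × ℝ))) : Set (Set (ℝ × ℝ)) :=
  {P | ∃ p ∈ (⋃ l ∈ L, l)ᶜ, P = connectedComponentIn ((⋃ l ∈ L, l)ᶜ) p}

/-- `B` is `Γ`-structured: a bijection `f : B → Γ` with `l ⊆ f l`. -/
def Structured (B Gam : Set (Set (ℝ × ℝ))) : Prop :=
  ∃ f : Set (ℝ × ℝ) → Set (ℝ × ℝ), Set.BijOn f B Gam ∧ ∀ l ∈ B, l ⊆ f l

theorem aux_alt (M : Finset ℝ) : ∃ G ⊆ M, M.card ≤ 2 * G.card ∧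
    ∀ a ∈ G, ∀ b ∈ G, a < b → ∃ c ∈ M \ G, a < c ∧ c < b := by
  suffices h : ∃ G ⊆ M, ((M.card = 2 * G.card ∧ ∀ a ∈ G, ∃ c ∈ M \ G, a < c) ∨
      M.card + 1 = 2 * G.card) ∧
      ∀ a ∈ G, ∀ b ∈ G, a < b → ∃ c ∈ M \ G, a < c ∧ c < b by
    obtain ⟨G, h1, h2, h3⟩ := h
    refine ⟨G, h1, ?_, h3⟩
    rcases h2 with h2 | h2
    · omega
    · omega
  induction M using Finset.induction_on_max with
  | empty => exact ⟨∅, by simp, by simp, by simp⟩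
  | insert x M hx ih =>
    obtain ⟨G, h1, h2, h3⟩ := ih
    have hxM : x ∉ M := fun h => lt_irrefl _ (hx x h)
    have hxG : x ∉ G := fun h => hxM (h1 h)
    rcases h2 with ⟨h2, h4⟩ | h2
    · refine ⟨insert x G, Finset.insert_subset_insert _ h1, Or.inr ?_, ?_⟩
      · rw [Finset.card_insert_of_notMem hxM, Finset.card_insert_of_notMem hxG]; omega
      · intro a ha b hb hab
        have key : ∀ c ∈ M \ G, c ∈ insert x M \ insert x G := by
          intro c hc
          simp only [Finset.mem_sdiff, Finset.mem_insert] at hc ⊢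
          refine ⟨Or.inr hc.1, ?_⟩
          rintro (h | h)
          · exact hxM (h ▸ hc.1)
          · exact hc.2 h
        rw [Finset.mem_insert] at ha hb
        rcases ha with rfl | ha
        · rcases hb with rfl | hb
          · exact absurd hab (lt_irrefl _)
          · exact absurd hab (not_lt.2 (hx b (h1 hb)).le)
        · rcases hb with rfl | hb
          · obtain ⟨c, hc, hac⟩ := h4 a ha
            exact ⟨c, key c hc, hac, hx c (Finset.mem_sdiff.1 hc).1⟩
          · obtain ⟨c, hc, hac⟩ := h3 a ha b hb hab
            exact ⟨c, key c hc, hac⟩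
    · refine ⟨G, h1.trans (Finset.subset_insert _ _), Or.inl ⟨?_, ?_⟩, ?_⟩
      · rw [Finset.card_insert_of_notMem hxM]; omega
      · intro a ha
        exact ⟨x, by simp [hxG], hx a (h1 ha)⟩
      · intro a ha b hb hab
        obtain ⟨c, hc, hac⟩ := h3 a ha b hb hab
        exact ⟨c, by simp only [Finset.mem_sdiff, Finset.mem_insert] at hc ⊢; tauto, hac⟩

def rk (S : Finset ℝ) (t : ℝ) : ℕ := (S.filter (· < t)).card

theorem rk_mono (S : Finset ℝ) {a b : ℝ} (h : a ≤ b) : rk S a ≤ rk S b := by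
  apply Finset.card_le_card
  intro s
  simp only [Finset.mem_filter]
  exact fun hs => ⟨hs.1, hs.2.trans_le h⟩

theorem rk_lt (S : Finset ℝ) {s b : ℝ} (hs : s ∈ S) (h : s < b) : rk S s < rk S b := by
  apply Finset.card_lt_card
  rw [Finset.ssubset_iff_of_subset]
  · exact ⟨s, by simp [hs, h], by simp⟩
  · intro s
    simp only [Finset.mem_filter]
    exact fun hs => ⟨hs.1, hs.2.trans h⟩

theorem rk_pred (S : Finset ℝ) {t : ℝ} (h : 0 < rk S t) :
    ∃ s ∈ S, s < t ∧ rk S s + 1 = rk S t ∧ ∀ s' ∈ S, s' < t → s' ≤ s := by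
  have hne : (S.filter (· < t)).Nonempty := Finset.card_pos.1 h
  obtain ⟨s, hs, hmax⟩ := Finset.exists_max_image _ id hne
  simp only [Finset.mem_filter, id, and_imp] at hs hmax
  refine ⟨s, hs.1, hs.2, ?_, hmax⟩
  unfold rk
  have : S.filter (· < t) = insert s (S.filter (· < s)) := by
    ext u
    simp only [Finset.mem_filter, Finset.mem_insert]
    constructor
    · rintro ⟨hu, hut⟩
      rcases (hmax u hu hut).eq_or_lt with h | h
      · exact Or.inl h
      · exact Or.inr ⟨hu, h⟩
    · rintro (rfl | h)
      · exact hs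
      · exact ⟨h.1, h.2.trans hs.2⟩
  rw [this, Finset.card_insert_of_notMem (by simp)]

theorem rk_succ (S : Finset ℝ) {t s0 : ℝ} (ht : t ∉ S) (h0 : s0 ∈ S) (h : t < s0) :
    ∃ s ∈ S, t < s ∧ rk S s = rk S t ∧ s ≤ s0 := by
  have hne : (S.filter (t < ·)).Nonempty := ⟨s0, by simp [h0, h]⟩
  obtain ⟨s, hs, hmin⟩ := Finset.exists_min_image _ id hne
  simp only [Finset.mem_filter, id, and_imp] at hs hmin
  refine ⟨s, hs.1, hs.2, ?_, hmin s0 h0 h⟩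
  unfold rk
  congr 1
  ext u
  simp only [Finset.mem_filter, and_congr_right_iff]
  intro hu
  constructor
  · intro hus
    by_contra hut
    rcases (not_lt.1 hut).eq_or_lt with h | h
    · exact ht (h ▸ hu)
    · exact absurd hus (not_lt.2 (hmin u hu h))
  · intro hut
    exact hut.trans hs.2

theorem rk_injOn (S : Finset ℝ) : Set.InjOn (rk S) S := by
  intro a ha b hb hab
  rcases lt_trichotomy a b with h | h | h
  · exact absurd hab (rk_lt S ha h).ne
  · exact h
  · exact absurd hab (rk_lt S hb h).ne'

theorem aux_fiber (W : Finset ℝ) (f : ℝ → ℕ) (h : ∀ t ∈ W, ∃ t' ∈ W, f t' = f t ∧ t' ≠ t) :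
    2 * (W.image f).card ≤ W.card := by
  classical
  rw [Finset.card_eq_sum_card_image f W, mul_comm, ← smul_eq_mul]
  apply Finset.card_nsmul_le_sum
  intro n hn
  obtain ⟨t, ht, rfl⟩ := Finset.mem_image.1 hn
  obtain ⟨t', ht', h1, h2⟩ := h t ht
  exact Finset.one_lt_card.2 ⟨t', by simp [ht', h1], t, by simp [ht], h2⟩

theorem core (S T : Finset ℝ) : ∃ G ⊆ T, ∃ V ⊆ S, 2 * (G.card + V.card) ≤ 3 * T.card ∧
    (∀ g ∈ G, g ∉ S) ∧
    (∀ g ∈ G, ∀ t ∈ T, t ∉ S → rk S t = rk S g → t = g) ∧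
    (∀ a ∈ G, ∀ b ∈ G, a < b → ∃ v ∈ V, a < v ∧ v < b) ∧
    (∀ a b : ℝ, (∃ s ∈ S, a ≤ s ∧ s ≤ b) → (∃ t ∈ T, a ≤ t ∧ t ≤ b) →
      (∃ v ∈ V, a ≤ v ∧ v ≤ b) ∨ ∃ g ∈ G, a ≤ g ∧ g ≤ b) := by
  classical
  let A := T \ S
  let M := A.filter (fun t => ∀ t' ∈ A, rk S t' = rk S t → t' = t)
  let W := A \ M
  obtain ⟨G, hGM, hcard, halt⟩ := aux_alt M
  let X := A \ G
  let V := S.filter (fun s => s ∈ T) ∪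
    (S.filter (fun s => rk S s ∈ X.image (rk S)) ∪ S.filter (fun s => rk S s + 1 ∈ X.image (rk S)))
  have hMA : M ⊆ A := Finset.filter_subset _ _
  have hGA : G ⊆ A := hGM.trans hMA
  have hGM' : ∀ g ∈ G, g ∈ T ∧ g ∉ S ∧ ∀ t' ∈ A, rk S t' = rk S g → t' = g := by
    intro g hg
    have := Finset.mem_filter.1 (hGM hg)
    have h2 := Finset.mem_sdiff.1 this.1
    exact ⟨h2.1, h2.2, this.2⟩
  have hVS : V ⊆ S := by
    intro v hv
    simp only [V, Finset.mem_union, Finset.mem_filter] at hv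
    tauto
  refine ⟨G, fun g hg => (hGM' g hg).1, V, hVS, ?_, fun g hg => (hGM' g hg).2.1, ?_, ?_, ?_⟩
  · have hW : 2 * (W.image (rk S)).card ≤ W.card := by
      apply aux_fiber
      intro t ht
      obtain ⟨htA, htM⟩ := Finset.mem_sdiff.1 ht
      have : ∃ t' ∈ A, rk S t' = rk S t ∧ t' ≠ t := by
        by_contra hcon
        push Not at hcon
        exact htM (Finset.mem_filter.2 ⟨htA, hcon⟩)
      obtain ⟨t', h1, h2, h3⟩ := this
      refine ⟨t', Finset.mem_sdiff.2 ⟨h1, fun h => ?_⟩, h2, h3⟩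
      exact h3 ((Finset.mem_filter.1 h).2 t htA h2.symm).symm
    have hX : X = (M \ G) ∪ W := by
      ext u
      have := @hMA u
      have := @hGM u
      simp only [X, W, Finset.mem_union, Finset.mem_sdiff]
      tauto
    have hXi : (X.image (rk S)).card ≤ (M \ G).card + (W.image (rk S)).card := by
      rw [hX, Finset.image_union]
      exact (Finset.card_union_le _ _).trans (Nat.add_le_add_right Finset.card_image_le _)
    have hV1 : (S.filter (fun s => rk S s ∈ X.image (rk S))).card ≤ (X.image (rk S)).card := by
      apply Finset.card_le_card_of_injOn (rk S)
      · intro s hs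
        exact (Finset.mem_filter.1 hs).2
      · exact (rk_injOn S).mono (by intro s hs; exact (Finset.mem_filter.1 hs).1)
    have hV2 : (S.filter (fun s => rk S s + 1 ∈ X.image (rk S))).card ≤ (X.image (rk S)).card := by
      apply Finset.card_le_card_of_injOn (fun s => rk S s + 1)
      · intro s hs
        exact (Finset.mem_filter.1 hs).2
      · intro s hs s' hs' h
        exact rk_injOn S (Finset.mem_filter.1 hs).1 (Finset.mem_filter.1 hs').1 (Nat.succ.inj h)
    have hVc : V.card ≤ (S.filter (fun s => s ∈ T)).card + 2 * (X.image (rk S)).card := by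
      have h1 := Finset.card_union_le (S.filter (fun s => s ∈ T))
        (S.filter (fun s => rk S s ∈ X.image (rk S)) ∪ S.filter (fun s => rk S s + 1 ∈ X.image (rk S)))
      have h2 := Finset.card_union_le (S.filter (fun s => rk S s ∈ X.image (rk S)))
        (S.filter (fun s => rk S s + 1 ∈ X.image (rk S)))
      change V.card ≤ _ at h1
      omega
    have hT : T.card = (S.filter (fun s => s ∈ T)).card + A.card := by
      have h1 : S.filter (fun s => s ∈ T) = T ∩ S := by
        ext u; simp [and_comm]
      have := Finset.card_inter_add_card_sdiff T S
      rw [h1]; exact this.symm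
    have hA : W.card + M.card = A.card := Finset.card_sdiff_add_card_eq_card hMA
    have hM : (M \ G).card + G.card = M.card := Finset.card_sdiff_add_card_eq_card hGM
    omega
  · intro g hg t ht htS h
    exact (hGM' g hg).2.2 t (Finset.mem_sdiff.2 ⟨ht, htS⟩) h
  · intro a ha b hb hab
    obtain ⟨c, hc, hac, hcb⟩ := halt a ha b hb hab
    obtain ⟨hcM, hcG⟩ := Finset.mem_sdiff.1 hc
    have h1 : rk S a < rk S c := by
      refine lt_of_le_of_ne (rk_mono S hac.le) fun h => ?_
      exact hac.ne' ((hGM' a ha).2.2 c (hMA hcM) h.symm)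
    obtain ⟨s, hs, hsc, hr, -⟩ := rk_pred S (Nat.zero_lt_of_lt h1)
    refine ⟨s, ?_, ?_, hsc.trans hcb⟩
    · simp only [V, Finset.mem_union, Finset.mem_filter, Finset.mem_image]
      exact Or.inr (Or.inr ⟨hs, c, Finset.mem_sdiff.2 ⟨hMA hcM, hcG⟩, hr.symm⟩)
    · by_contra h
      rcases (not_lt.1 h).eq_or_lt with h | h
      · exact (hGM' a ha).2.1 (h ▸ hs)
      · have := rk_lt S hs h
        omega
  · rintro a b ⟨s, hs, has, hsb⟩ ⟨t, ht, hat, htb⟩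
    by_cases htS : t ∈ S
    · exact Or.inl ⟨t, by simp [V, htS, ht], hat, htb⟩
    by_cases htG : t ∈ G
    · exact Or.inr ⟨t, htG, hat, htb⟩
    have htX : t ∈ X := Finset.mem_sdiff.2 ⟨Finset.mem_sdiff.2 ⟨ht, htS⟩, htG⟩
    left
    rcases lt_trichotomy s t with h | h | h
    · obtain ⟨s', hs', h1, h2, h3⟩ := rk_pred S (Nat.zero_lt_of_lt (rk_lt S hs h))
      refine ⟨s', ?_, has.trans (h3 s hs h), h1.le.trans htb⟩
      simp only [V, Finset.mem_union, Finset.mem_filter, Finset.mem_image]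
      exact Or.inr (Or.inr ⟨hs', t, htX, h2.symm⟩)
    · exact absurd (h ▸ hs) htS
    · obtain ⟨s', hs', h1, h2, h3⟩ := rk_succ S htS hs h
      refine ⟨s', ?_, hat.trans h1.le, h3.trans hsb⟩
      simp only [V, Finset.mem_union, Finset.mem_filter, Finset.mem_image]
      exact Or.inr (Or.inl ⟨hs', t, htX, h2.symm⟩)

theorem vline_inj : Function.Injective vline := by
  intro a b h
  have : ((a, 0) : ℝ × ℝ) ∈ vline b := h ▸ (rfl : ((a, 0) : ℝ × ℝ).1 = a)
  exact this

theorem vset_coords (V : Set (Set (ℝ × ℝ))) (hf : V.Finite) (hV : IsVLineSet V) :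
    ∃ S : Finset ℝ, V = vline '' (S : Set ℝ) := by
  have hf' : (vline ⁻¹' V).Finite := hf.preimage vline_inj.injOn
  refine ⟨hf'.toFinset, ?_⟩
  ext l
  simp only [Set.Finite.coe_toFinset, Set.mem_image, Set.mem_preimage]
  constructor
  · intro hl
    obtain ⟨x, rfl⟩ := hV l hl
    exact ⟨x, hl, rfl⟩
  · rintro ⟨x, hx, rfl⟩
    exact hx

theorem stabs_vline {a b c d x : ℝ} (hcd : c ≤ d) :
    Stabs (vline x) (rect a b c d) ↔ a ≤ x ∧ x ≤ b := by
  constructor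
  · rintro ⟨⟨p, q⟩, ⟨hp, -⟩, h⟩
    have : p = x := h
    subst this
    exact hp
  · intro h
    exact ⟨(x, c), ⟨h, ⟨le_rfl, hcd⟩⟩, rfl⟩

def cmp0 (S : Finset ℝ) (t : ℝ) : Set (ℝ × ℝ) :=
  connectedComponentIn ((⋃ l ∈ vline '' (S : Set ℝ), l)ᶜ) (t, 0)

theorem mem_compl0 (S : Finset ℝ) (p : ℝ × ℝ) :
    p ∈ ((⋃ l ∈ vline '' (S : Set ℝ), l)ᶜ : Set (ℝ × ℝ)) ↔ p.1 ∉ S := by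
  simp [vline]

theorem vline_sub_cmp0 (S : Finset ℝ) {t : ℝ} (ht : t ∉ S) : vline t ⊆ cmp0 S t := by
  apply IsPreconnected.subset_connectedComponentIn
  · have : vline t = (fun y : ℝ => (t, y)) '' Set.univ := by
      ext ⟨a, b⟩
      simp [vline, eq_comm]
    rw [this]
    exact isPreconnected_univ.image _ (by fun_prop)
  · rfl
  · intro p hp
    rw [mem_compl0]
    have : p.1 = t := hp
    rwa [this]

theorem cmp0_notMem (S : Finset ℝ) {t : ℝ} {p : ℝ × ℝ} (hp : p ∈ cmp0 S t) : p.1 ∉ S :=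
  (mem_compl0 S p).1 (connectedComponentIn_subset _ _ hp)

theorem cmp0_side (S : Finset ℝ) {t : ℝ} (ht : t ∉ S) {p : ℝ × ℝ} (hp : p ∈ cmp0 S t)
    {s : ℝ} (hs : s ∈ S) : (p.1 < s ↔ t < s) := by
  have hpre : (Prod.fst '' cmp0 S t).OrdConnected :=
    (isPreconnected_connectedComponentIn.image _ continuous_fst.continuousOn).ordConnected
  have h1 : p.1 ∈ Prod.fst '' cmp0 S t := ⟨p, hp, rfl⟩
  have h2 : t ∈ Prod.fst '' cmp0 S t := ⟨(t, 0), vline_sub_cmp0 S ht rfl, rfl⟩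
  have h3 : s ∉ Prod.fst '' cmp0 S t := by
    rintro ⟨q, hq, rfl⟩
    exact cmp0_notMem S hq hs
  constructor
  · intro h
    by_contra h'
    exact h3 (hpre.out h1 h2 ⟨h.le, not_lt.1 h'⟩)
  · intro h
    by_contra h'
    exact h3 (hpre.out h2 h1 ⟨h.le, not_lt.1 h'⟩)

theorem cmp0_rk (S : Finset ℝ) {t : ℝ} (ht : t ∉ S) {p : ℝ × ℝ} (hp : p ∈ cmp0 S t) :
    rk S p.1 = rk S t := by
  unfold rk
  congr 1
  ext s
  simp only [Finset.mem_filter, and_congr_right_iff]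
  intro hs
  have h := cmp0_side S ht hp hs
  have h1 : s ≠ p.1 := fun h => cmp0_notMem S hp (h ▸ hs)
  have h2 : s ≠ t := fun h => ht (h ▸ hs)
  constructor
  · intro h3
    exact lt_of_le_of_ne (not_lt.1 fun h4 => absurd (h.2 h4) h3.not_gt) h2
  · intro h3
    exact lt_of_le_of_ne (not_lt.1 fun h4 => absurd (h.1 h4) h3.not_gt) h1

theorem stmt2 (R H₁ V₀ Hs Vs : Set (Set (ℝ × ℝ)))
    (hRfin : R.Finite) (hRrect : ∀ r ∈ R, IsRect r)
    (hH₁fin : H₁.Finite) (hH₁ : IsHLineSet H₁)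
    (hV₀fin : V₀.Finite) (hV₀ : IsVLineSet V₀)
    (hHsfin : Hs.Finite) (hHs : IsHLineSet Hs)
    (hVsfin : Vs.Finite) (hVs : IsVLineSet Vs)
    (hstab0 : StabsAll (H₁ ∪ V₀) R)
    (hstabs : StabsAll (Hs ∪ Vs) R) :
    ∃ Gv ⊆ components V₀, ∃ V₁ ⊆ V₀,
      Gv.Finite ∧
      2 * (Gv.ncard + V₁.ncard) ≤ 3 * Vs.ncard ∧
      VSeparated Gv V₁ ∧
      ∃ sel : Set (ℝ × ℝ) → Set (ℝ × ℝ),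
        (∀ P ∈ Gv, sel P ∈ Vs ∧ sel P ⊆ P ∧ ∀ v ∈ Vs, v ⊆ P → v = sel P) ∧
        StabsAll (H₁ ∪ V₁ ∪ Hs ∪ (sel '' Gv)) R := by
  classical
  obtain ⟨S, rfl⟩ := vset_coords V₀ hV₀fin hV₀
  obtain ⟨T, rfl⟩ := vset_coords Vs hVsfin hVs
  obtain ⟨G, hGT, V, hVS, hcard, hGS, huniq, hsep, hst⟩ := core S T
  have huniq' : ∀ g ∈ G, ∀ t ∈ T, vline t ⊆ cmp0 S g → t = g := by
    intro g hg t ht h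
    have hm : ((t, 0) : ℝ × ℝ) ∈ cmp0 S g := h rfl
    exact huniq g hg t ht (cmp0_notMem S hm) (cmp0_rk S (hGS g hg) hm)
  let sel : Set (ℝ × ℝ) → Set (ℝ × ℝ) := fun P =>
    if h : ∃ g ∈ G, P = cmp0 S g then vline h.choose else ∅
  have hsel : ∀ g ∈ G, sel (cmp0 S g) = vline g := by
    intro g hg
    have h : ∃ g' ∈ G, cmp0 S g = cmp0 S g' := ⟨g, hg, rfl⟩
    have h1 : sel (cmp0 S g) = vline h.choose := dif_pos h
    rw [h1]
    congr 1
    apply huniq' g hg _ (hGT h.choose_spec.1)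
    have h2 := vline_sub_cmp0 S (hGS _ h.choose_spec.1)
    exact h2.trans h.choose_spec.2.symm.subset
  refine ⟨cmp0 S '' (G : Set ℝ), ?_, vline '' (V : Set ℝ), Set.image_mono (by exact_mod_cast hVS),
    G.finite_toSet.image _, ?_, ⟨?_, ?_⟩, sel, ?_, ?_⟩
  · rintro _ ⟨g, hg, rfl⟩
    exact ⟨(g, 0), (mem_compl0 S _).2 (hGS g hg), rfl⟩
  · have h1 : (cmp0 S '' (G : Set ℝ)).ncard ≤ G.card := by
      simpa using Set.ncard_image_le (f := cmp0 S) G.finite_toSet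
    have h2 : (vline '' (V : Set ℝ)).ncard ≤ V.card := by
      simpa using Set.ncard_image_le (f := vline) V.finite_toSet
    have h3 : (vline '' (T : Set ℝ)).ncard = T.card := by
      rw [Set.ncard_image_of_injective _ vline_inj, Set.ncard_coe_finset]
    omega
  · rintro _ ⟨g, hg, rfl⟩ _ ⟨g', hg', rfl⟩ hne
    rcases lt_trichotomy g g' with h | h | h
    · obtain ⟨v, hv, h1, h2⟩ := hsep g hg g' hg' h
      refine ⟨vline v, ⟨v, hv, rfl⟩, v, rfl, Or.inl ⟨?_, ?_⟩⟩
      · exact fun p hp => (cmp0_side S (hGS g hg) hp (hVS hv)).2 h1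
      · intro p hp
        refine lt_of_le_of_ne (not_lt.1 fun h4 => ?_) fun h => cmp0_notMem S hp (h ▸ hVS hv)
        exact absurd ((cmp0_side S (hGS g' hg') hp (hVS hv)).1 h4) h2.not_gt
    · exact absurd (by rw [h]) hne
    · obtain ⟨v, hv, h1, h2⟩ := hsep g' hg' g hg h
      refine ⟨vline v, ⟨v, hv, rfl⟩, v, rfl, Or.inr ⟨?_, ?_⟩⟩
      · exact fun p hp => (cmp0_side S (hGS g' hg') hp (hVS hv)).2 h1
      · intro p hp
        refine lt_of_le_of_ne (not_lt.1 fun h4 => ?_) fun h => cmp0_notMem S hp (h ▸ hVS hv)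
        exact absurd ((cmp0_side S (hGS g hg) hp (hVS hv)).1 h4) h2.not_gt
  · rintro _ ⟨g, hg, rfl⟩ _ ⟨v, hv, rfl⟩
    rw [Set.eq_empty_iff_forall_notMem]
    rintro p ⟨hp, hpv⟩
    have : p.1 = v := hpv
    exact cmp0_notMem S hp (this ▸ hVS hv)
  · rintro _ ⟨g, hg, rfl⟩
    rw [hsel g hg]
    refine ⟨⟨g, hGT hg, rfl⟩, vline_sub_cmp0 S (hGS g hg), ?_⟩
    rintro _ ⟨t, ht, rfl⟩ h
    rw [huniq' g hg t ht h]
  · intro r hr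
    obtain ⟨l, hl, hlr⟩ := hstab0 r hr
    obtain ⟨l', hl', hlr'⟩ := hstabs r hr
    rcases hl with hl | ⟨s, hs, rfl⟩
    · exact ⟨l, Or.inl (Or.inl (Or.inl hl)), hlr⟩
    rcases hl' with hl' | ⟨t, ht, rfl⟩
    · exact ⟨l', Or.inl (Or.inr hl'), hlr'⟩
    obtain ⟨a, b, c, d, hab, hcd, rfl⟩ := hRrect r hr
    rw [stabs_vline hcd] at hlr hlr'
    rcases hst a b ⟨s, hs, hlr⟩ ⟨t, ht, hlr'⟩ with ⟨v, hv, h⟩ | ⟨g, hg, h⟩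
    · exact ⟨vline v, Or.inl (Or.inl (Or.inr ⟨v, hv, rfl⟩)), (stabs_vline hcd).2 h⟩
    · exact ⟨vline g, Or.inr ⟨cmp0 S g, ⟨g, hg, rfl⟩, hsel g hg⟩, (stabs_vline hcd).2 h⟩
end
end

section
/- Let x⁻ < x⁺ be reals, let P = (x⁻, x⁺) × ℝ be a vertical strip, and let ℓ be one of the two vertical lines ℓ_v^{x⁻}, ℓ_v^{x⁺}. For a rectangle R, let wid_P(R) denote the length of the projection of R ∩ P onto the x-axis. Let R and R* be rectangles such that R ∩ P ≠ ∅, R* ∩ P ≠ ∅, both R and R* are stabbed by ℓ, and wid_P(R*) ≥ wid_P(R). Then every vertical line contained in P that stabs R also stabs R*. -/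
open Set MeasureTheory

noncomputable section

theorem stmt4 (xm xp : ℝ) (hx : xm < xp) (l R Rs : Set (ℝ × ℝ))
    (hl : l = vline xm ∨ l = vline xp)
    (hR : IsRect R) (hRs : IsRect Rs)
    (hRP : (R ∩ vstrip xm xp).Nonempty)
    (hRsP : (Rs ∩ vstrip xm xp).Nonempty)
    (hstabR : Stabs l R) (hstabRs : Stabs l Rs)
    (hwid : volume (Prod.fst '' (R ∩ vstrip xm xp)) ≤
            volume (Prod.fst '' (Rs ∩ vstrip xm xp))) :
    ∀ x : ℝ, vline x ⊆ vstrip xm xp → Stabs (vline x) R → Stabs (vline x) Rs := by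
  intro x hxP hxR
  obtain ⟨a, b, c, d, hab, hcd, rfl⟩ := hR
  obtain ⟨a', b', c', d', hab', hcd', rfl⟩ := hRs
  have hxs : xm < x ∧ x < xp := hxP (show ((x, 0) : ℝ × ℝ) ∈ vline x from rfl)
  obtain ⟨p, ⟨⟨hax, hxb⟩, -⟩, hpx⟩ := hxR
  have hpx : p.1 = x := hpx
  rw [hpx] at hax hxb
  obtain ⟨h1, h2⟩ := hxs
  suffices h : a' ≤ x ∧ x ≤ b' from
    ⟨(x, c'), ⟨h, le_refl _, hcd'⟩, rfl⟩
  obtain ⟨q, ⟨⟨hq1, hq2⟩, -⟩, hql⟩ := hstabR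
  obtain ⟨r, ⟨⟨hr1, hr2⟩, -⟩, hrl⟩ := hstabRs
  rcases hl with rfl | rfl
  · have hql : q.1 = xm := hql
    have hrl : r.1 = xm := hrl
    rw [hql] at hq1 hq2
    rw [hrl] at hr1 hr2
    refine ⟨by linarith, ?_⟩
    have e1 : Set.Ioc xm x ⊆ Prod.fst '' (rect a b c d ∩ vstrip xm xp) := by
      rintro z ⟨hz1, hz2⟩
      exact ⟨(z, c), ⟨⟨⟨by linarith, by linarith⟩, le_refl _, hcd⟩, hz1, by
        show z < xp
        linarith⟩, rfl⟩
    have e2 : Prod.fst '' (rect a' b' c' d' ∩ vstrip xm xp) ⊆ Set.Ioc xm b' := by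
      rintro _ ⟨z, ⟨⟨⟨hz1, hz2⟩, -⟩, hz3, hz4⟩, rfl⟩
      exact ⟨hz3, hz2⟩
    have h := (measure_mono e1).trans (hwid.trans (measure_mono e2))
    rw [Real.volume_Ioc, Real.volume_Ioc, ENNReal.ofReal_le_ofReal_iff (by linarith)] at h
    linarith
  · have hql : q.1 = xp := hql
    have hrl : r.1 = xp := hrl
    rw [hql] at hq1 hq2
    rw [hrl] at hr1 hr2
    refine ⟨?_, by linarith⟩
    have e1 : Set.Ico x xp ⊆ Prod.fst '' (rect a b c d ∩ vstrip xm xp) := by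
      rintro z ⟨hz1, hz2⟩
      exact ⟨(z, c), ⟨⟨⟨by linarith, by linarith⟩, le_refl _, hcd⟩, by
        show xm < z
        linarith, hz2⟩, rfl⟩
    have e2 : Prod.fst '' (rect a' b' c' d' ∩ vstrip xm xp) ⊆ Set.Ico a' xp := by
      rintro _ ⟨z, ⟨⟨⟨hz1, hz2⟩, -⟩, hz3, hz4⟩, rfl⟩
      exact ⟨hz1, hz4⟩
    have h := (measure_mono e1).trans (hwid.trans (measure_mono e2))
    rw [Real.volume_Ico, Real.volume_Ico, ENNReal.ofReal_le_ofReal_iff (by linarith)] at h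
    linarith
end
end

section
/- Let 𝓚 be a finite set of rectangles, 𝓗 a finite set of horizontal lines, 𝓥₁ a finite set of vertical lines, and let 𝓗₁, 𝓗₀, 𝓗* ⊆ 𝓗 with k_h = |𝓗*|. Let 𝓦 be a finite set of vertical lines. Assume: (a) 𝓗₁ is nicely positioned with respect to 𝓗*; (b) every rectangle R ∈ 𝓚 that is stabbed by 𝓗 but not by 𝓗₁ ∪ 𝓥₁ is stabbed by 𝓗₀; and (c) 𝓚 is stabbed by 𝓗₁ ∪ 𝓥₁ ∪ 𝓗* ∪ 𝓦. Then there exist Γ_h ⊆ Γ(𝓗₁ ∪ 𝓗₀) and 𝓗₁' ⊆ 𝓗₀ satisfying: (i) |𝓗₁| + |Γ_h| + |𝓗₁'| ≤ 2·k_h; (ii) Γ_h is separated by 𝓗₁ ∪ 𝓗₁'; (iii) for each Q ∈ Γ_h there exists exactly one line h*_Q ∈ 𝓗* with h*_Q ⊆ Q; and (iv) 𝓚 is stabbed by 𝓗₁ ∪ 𝓥₁ ∪ 𝓗₁' ∪ {h*_Q : Q ∈ Γ_h} ∪ 𝓦. -/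
open Set MeasureTheory

noncomputable section

theorem comb_aux (Y1 Y0 S : Finset ℝ)
    (hn : ∀ y ∈ Y1, ∃ z ∈ S, z ≤ y ∧ ∀ y' ∈ Y1, y' < y → y' < z) :
    ∃ A ⊆ S, ∃ T ⊆ Y0, Y1.card + A.card + T.card ≤ 2 * S.card ∧
      (∀ s ∈ A, s ∉ Y1 ∧ s ∉ Y0 ∧
        ∀ s' ∈ S, (∀ y ∈ Y1 ∪ Y0, y ∉ Set.uIcc s s') → s' = s) ∧
      (∀ s ∈ A, ∀ s' ∈ A, s < s' → ∃ y, (y ∈ Y1 ∨ y ∈ T) ∧ s < y ∧ y < s') ∧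
      (∀ c d : ℝ, ∀ s ∈ S, ∀ t ∈ Y0, s ∈ Set.Icc c d → t ∈ Set.Icc c d →
        (∀ y ∈ Y1, y ∉ Set.Icc c d) → ∃ y, (y ∈ T ∨ y ∈ A) ∧ y ∈ Set.Icc c d) := by
  classical
  have hb : ∀ s : ℝ, ∃ b : ℝ, ∀ t ∈ Y1 ∪ Y0, t < s → b ∈ Y1 ∪ Y0 ∧ b < s ∧ t ≤ b := by
    intro s
    by_cases h : ((Y1 ∪ Y0).filter (· < s)).Nonempty
    · obtain ⟨b, hb, hmax⟩ := Finset.exists_max_image _ id h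
      refine ⟨b, fun t ht hts => ?_⟩
      have h1 := Finset.mem_filter.1 hb
      exact ⟨h1.1, h1.2, hmax t (Finset.mem_filter.2 ⟨ht, hts⟩)⟩
    · refine ⟨0, fun t ht hts => ?_⟩
      exact absurd ⟨t, Finset.mem_filter.2 ⟨ht, hts⟩⟩ h
  have hu : ∀ s : ℝ, ∃ u : ℝ, ∀ t ∈ Y1 ∪ Y0, s < t → u ∈ Y1 ∪ Y0 ∧ s < u ∧ u ≤ t := by
    intro s
    by_cases h : ((Y1 ∪ Y0).filter (s < ·)).Nonempty
    · obtain ⟨b, hb, hmax⟩ := Finset.exists_min_image _ id h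
      refine ⟨b, fun t ht hts => ?_⟩
      have h1 := Finset.mem_filter.1 hb
      exact ⟨h1.1, h1.2, hmax t (Finset.mem_filter.2 ⟨ht, hts⟩)⟩
    · refine ⟨0, fun t ht hts => ?_⟩
      exact absurd ⟨t, Finset.mem_filter.2 ⟨ht, hts⟩⟩ h
  choose b hb using hb
  choose u hu using hu
  set F := S.filter (fun s => ∀ s' ∈ S, s' < s → ∃ y ∈ Y1, s' ≤ y ∧ y < s) with hF
  set N := S.filter (fun s => ¬ ∀ s' ∈ S, s' < s → ∃ y ∈ Y1, s' ≤ y ∧ y < s) with hN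
  have hFN : F.card + N.card = S.card := Finset.card_filter_add_card_filter_not _
  have hYF : Y1.card ≤ F.card := by
    have : ∀ y ∈ Y1, ∃ s ∈ F, s ≤ y ∧ ∀ y' ∈ Y1, y' < y → y' < s := by
      intro y hy
      have hne : (S.filter (fun z => z ≤ y ∧ ∀ y' ∈ Y1, y' < y → y' < z)).Nonempty := by
        obtain ⟨z, hz, h⟩ := hn y hy
        exact ⟨z, Finset.mem_filter.2 ⟨hz, h⟩⟩
      obtain ⟨s, hs, hmin⟩ := Finset.exists_min_image _ id hne
      obtain ⟨h1, h2, h3⟩ := Finset.mem_filter.1 hs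
      refine ⟨s, Finset.mem_filter.2 ⟨h1, fun s' hs' hlt => ?_⟩, h2, h3⟩
      by_contra hcon
      push Not at hcon
      have : s ≤ s' := hmin s' (Finset.mem_filter.2 ⟨hs', by linarith, fun y' hy' hy'y => by
        by_contra hc
        have := hcon y' hy' (by linarith)
        have := h3 y' hy' hy'y
        linarith⟩)
      linarith
    choose! f hf1 hf2 hf3 using this
    apply Finset.card_le_card_of_injOn f hf1
    intro y hy y' hy' he
    rcases lt_trichotomy y y' with h | h | h
    · have h1 := hf3 y' hy' y hy h
      have h2 := hf2 y hy
      linarith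
    · exact h
    · have h1 := hf3 y hy y' hy' h
      have h2 := hf2 y' hy'
      linarith
  set C : ℝ → Prop := fun s => ∀ s' ∈ S, (∀ y ∈ Y1 ∪ Y0, y ∉ Set.uIcc s s') → s' = s with hC
  set E := S.filter (fun s => s ∉ Y1 ∪ Y0) with hE
  set O := S.filter (fun s => ¬ s ∉ Y1 ∪ Y0) with hO
  have hEO : E.card + O.card = S.card := Finset.card_filter_add_card_filter_not _
  set A := E.filter C with hA
  set B := E.filter (fun s => ¬ C s) with hB
  have hAB : A.card + B.card = E.card := Finset.card_filter_add_card_filter_not _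
  set NA := N.filter C with hNA
  set NB := N.filter (fun s => ¬ C s) with hNB
  have hNAB : NA.card + NB.card = N.card := Finset.card_filter_add_card_filter_not _
  set T := (O ∪ B.image b ∪ NA.image b ∪ NB.image u) ∩ Y0 with hT
  have hTc : T.card ≤ O.card + B.card + NA.card + NB.card := by
    refine (Finset.card_le_card Finset.inter_subset_left).trans ?_
    refine (Finset.card_union_le _ _).trans (add_le_add ?_ Finset.card_image_le)
    refine (Finset.card_union_le _ _).trans (add_le_add ?_ Finset.card_image_le)
    exact (Finset.card_union_le _ _).trans (add_le_add le_rfl Finset.card_image_le)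
  have memT : ∀ y, y ∈ Y0 → (y ∈ O ∨ (∃ s ∈ B, b s = y) ∨ (∃ s ∈ NA, b s = y) ∨
      (∃ s ∈ NB, u s = y)) → y ∈ T := by
    intro y hy h
    simp only [hT, Finset.mem_inter, Finset.mem_union, Finset.mem_image]
    refine ⟨?_, hy⟩
    rcases h with h | h | h | h
    · exact Or.inl (Or.inl (Or.inl h))
    · exact Or.inl (Or.inl (Or.inr h))
    · exact Or.inl (Or.inr h)
    · exact Or.inr h
  refine ⟨A, (Finset.filter_subset _ _).trans (Finset.filter_subset _ _), T,
    Finset.inter_subset_right, by omega, ?_, ?_, ?_⟩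
  · intro s hs
    obtain ⟨h1, h2⟩ := Finset.mem_filter.1 hs
    have h3 := (Finset.mem_filter.1 h1).2
    rw [Finset.mem_union] at h3
    push Not at h3
    exact ⟨h3.1, h3.2, h2⟩
  · intro s hs s' hs' hlt
    obtain ⟨h1, h2⟩ := Finset.mem_filter.1 hs
    obtain ⟨h1', h2'⟩ := Finset.mem_filter.1 hs'
    obtain ⟨h3, h4⟩ := Finset.mem_filter.1 h1
    obtain ⟨h3', h4'⟩ := Finset.mem_filter.1 h1'
    by_cases hsF : ∀ z ∈ S, z < s' → ∃ y ∈ Y1, z ≤ y ∧ y < s'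
    · obtain ⟨y, hy, hy1, hy2⟩ := hsF s h3 hlt
      refine ⟨y, Or.inl hy, lt_of_le_of_ne hy1 ?_, hy2⟩
      rintro rfl
      exact h4 (Finset.mem_union_left _ hy)
    · have hsN : s' ∈ NA := Finset.mem_filter.2 ⟨Finset.mem_filter.2 ⟨h3', hsF⟩, h2'⟩
      have : ∃ y ∈ Y1 ∪ Y0, y ∈ Set.uIcc s s' := by
        by_contra hc
        push Not at hc
        exact hlt.ne' (h2 s' h3' hc)
      obtain ⟨y, hy, hym⟩ := this
      rw [Set.uIcc_of_le hlt.le] at hym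
      have hys : s < y := lt_of_le_of_ne hym.1 (by rintro rfl; exact h4 hy)
      have hys' : y < s' := lt_of_le_of_ne hym.2 (by rintro rfl; exact h4' hy)
      obtain ⟨k1, k2, k3⟩ := hb s' y hy hys'
      refine ⟨b s', ?_, by linarith, k2⟩
      rcases Finset.mem_union.1 k1 with k | k
      · exact Or.inl k
      · exact Or.inr (memT _ k (Or.inr (Or.inr (Or.inl ⟨s', hsN, rfl⟩))))
  · intro c d s hs t ht hsI htI hno
    have hno' : ∀ y ∈ Y1 ∪ Y0, y ∈ Set.Icc c d → y ∈ Y0 := by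
      intro y hy hyI
      rcases Finset.mem_union.1 hy with k | k
      · exact absurd hyI (hno y k)
      · exact k
    by_cases hsE : s ∉ Y1 ∪ Y0
    swap
    · have h0 := hno' s (not_not.1 hsE) hsI
      exact ⟨s, Or.inl (memT _ h0 (Or.inl (Finset.mem_filter.2 ⟨hs, hsE⟩))), hsI⟩
    have hsE' : s ∈ E := Finset.mem_filter.2 ⟨hs, hsE⟩
    by_cases hCs : C s
    · exact ⟨s, Or.inr (Finset.mem_filter.2 ⟨hsE', hCs⟩), hsI⟩
    have hsB : s ∈ B := Finset.mem_filter.2 ⟨hsE', hCs⟩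
    have htY : t ∈ Y1 ∪ Y0 := Finset.mem_union_right _ ht
    rcases lt_trichotomy t s with h | h | h
    · obtain ⟨k1, k2, k3⟩ := hb s t htY h
      have hI : b s ∈ Set.Icc c d := ⟨htI.1.trans k3, k2.le.trans hsI.2⟩
      exact ⟨b s, Or.inl (memT _ (hno' _ k1 hI) (Or.inr (Or.inl ⟨s, hsB, rfl⟩))), hI⟩
    · exact absurd (h ▸ htY) hsE
    · have key : ∃ z ∈ NB, ∀ y ∈ Y1 ∪ Y0, y ∉ Set.uIcc s z := by
        have hCs' := hCs
        simp only [hC] at hCs'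
        push Not at hCs'
        obtain ⟨s', hs', hcl, hne⟩ := hCs'
        rcases lt_or_gt_of_ne hne with hl | hl
        · refine ⟨s, Finset.mem_filter.2 ⟨Finset.mem_filter.2 ⟨hs, fun hh => ?_⟩, hCs⟩, ?_⟩
          · obtain ⟨y, hy, hy1, hy2⟩ := hh s' hs' hl
            exact hcl y (Finset.mem_union_left _ hy) (Set.mem_uIcc.2 (Or.inr ⟨hy1, hy2.le⟩))
          · intro y hy hm
            rw [Set.uIcc_self] at hm
            exact hsE (hm ▸ hy)
        · refine ⟨s', Finset.mem_filter.2 ⟨Finset.mem_filter.2 ⟨hs', fun hh => ?_⟩, fun hh => ?_⟩, hcl⟩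
          · obtain ⟨y, hy, hy1, hy2⟩ := hh s hs hl
            exact hcl y (Finset.mem_union_left _ hy) (Set.mem_uIcc.2 (Or.inl ⟨hy1, hy2.le⟩))
          · exact hne (hh s hs (by rwa [Set.uIcc_comm])).symm
      obtain ⟨z, hz, hzc⟩ := key
      have cl : ∀ y ∈ Y1 ∪ Y0, s < y → z < y := by
        intro y hy hsy
        by_contra hc
        exact hzc y hy (Set.mem_uIcc.2 (Or.inl ⟨hsy.le, not_lt.1 hc⟩))
      obtain ⟨k1, k2, k3⟩ := hu z t htY (cl t htY h)
      have hsu : s < u z := by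
        by_contra hc
        exact hzc _ k1 (Set.mem_uIcc.2 (Or.inr ⟨k2.le, not_lt.1 hc⟩))
      have hI : u z ∈ Set.Icc c d := ⟨hsI.1.trans hsu.le, k3.trans htI.2⟩
      exact ⟨u z, Or.inl (memT _ (hno' _ k1 hI) (Or.inr (Or.inr (Or.inr ⟨z, hz, rfl⟩)))), hI⟩

theorem hline_inj : Function.Injective hline := by
  intro a b h
  have : ((0 : ℝ), a) ∈ hline b := h ▸ (rfl : ((0 : ℝ), a).2 = a)
  exact this

theorem lines_eq (H : Set (Set (ℝ × ℝ))) (hf : H.Finite) (hl : IsHLineSet H) :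
    ∃ Y : Finset ℝ, H = hline '' (Y : Set ℝ) := by
  have hfin : (hline ⁻¹' H).Finite := hf.preimage hline_inj.injOn
  refine ⟨hfin.toFinset, ?_⟩
  rw [hfin.coe_toFinset, Set.image_preimage_eq_of_subset]
  intro l h
  obtain ⟨y, rfl⟩ := hl l h
  exact ⟨y, rfl⟩

theorem stab_hline {r : Set (ℝ × ℝ)} {a b c d y : ℝ} (hab : a ≤ b) (hr : r = rect a b c d) :
    Stabs (hline y) r ↔ y ∈ Set.Icc c d := by
  subst hr
  constructor
  · rintro ⟨p, hp, hy⟩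
    have hy : p.2 = y := hy
    exact hy ▸ hp.2
  · intro h
    exact ⟨(a, y), ⟨⟨le_rfl, hab⟩, h⟩, rfl⟩

theorem comp_eq (Y : Set ℝ) (p : ℝ × ℝ) (hp : p.2 ∉ Y) :
    connectedComponentIn ((⋃ l ∈ hline '' Y, l)ᶜ) p =
      {q : ℝ × ℝ | ∀ y ∈ Y, y ∉ Set.uIcc p.2 q.2} := by
  have hmem : ∀ q : ℝ × ℝ, q ∈ (⋃ l ∈ hline '' Y, l)ᶜ ↔ q.2 ∉ Y := by
    intro q
    simp only [hline, Set.mem_compl_iff, Set.mem_iUnion, Set.mem_image, exists_prop]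
    constructor
    · intro h hq
      exact h ⟨_, ⟨q.2, hq, rfl⟩, rfl⟩
    · rintro h ⟨_, ⟨y, hy, rfl⟩, hq⟩
      have hq : q.2 = y := hq
      exact h (hq ▸ hy)
  apply Set.Subset.antisymm
  · intro q hq y hy hyI
    have hpre : IsPreconnected (Prod.snd '' connectedComponentIn ((⋃ l ∈ hline '' Y, l)ᶜ) p) :=
      isPreconnected_connectedComponentIn.image _ continuous_snd.continuousOn
    have hpc : p ∈ connectedComponentIn ((⋃ l ∈ hline '' Y, l)ᶜ) p :=
      mem_connectedComponentIn ((hmem p).2 hp)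
    have := hpre.ordConnected.uIcc_subset ⟨p, hpc, rfl⟩ ⟨q, hq, rfl⟩ hyI
    obtain ⟨w, hw, rfl⟩ := this
    exact (hmem w).1 (connectedComponentIn_subset _ _ hw) hy
  · apply IsPreconnected.subset_connectedComponentIn
    · have hoc : Set.OrdConnected {z : ℝ | ∀ y ∈ Y, y ∉ Set.uIcc p.2 z} := by
        constructor
        intro a ha b hb z hz y hy hyI
        have h1 := ha y hy
        have h2 := hb y hy
        rw [Set.mem_uIcc] at h1 h2 hyI
        obtain ⟨hz1, hz2⟩ := hz
        push Not at h1 h2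
        rcases hyI with ⟨h3, h4⟩ | ⟨h3, h4⟩
        · have := h2.1 h3
          linarith
        · by_contra _
          have := h1.2 (by linarith)
          linarith
      have : {q : ℝ × ℝ | ∀ y ∈ Y, y ∉ Set.uIcc p.2 q.2} =
          Set.univ ×ˢ {z : ℝ | ∀ y ∈ Y, y ∉ Set.uIcc p.2 z} := by
        ext q; simp
      rw [this]
      exact isPreconnected_univ.prod hoc.isPreconnected
    · intro y hy hyI
      rw [Set.uIcc_self] at hyI
      exact hp (hyI ▸ hy)
    · intro q hq
      rw [hmem]
      intro hqY
      exact hq _ hqY Set.right_mem_uIcc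

theorem stmt6 (K Hl V₁ W H₁ H₀ Hs : Set (Set (ℝ × ℝ)))
    (hKfin : K.Finite) (hKrect : ∀ r ∈ K, IsRect r)
    (hHlfin : Hl.Finite) (hHl : IsHLineSet Hl)
    (hV₁fin : V₁.Finite) (hV₁ : IsVLineSet V₁)
    (hWfin : W.Finite) (hW : IsVLineSet W)
    (hH₁ : H₁ ⊆ Hl) (hH₀ : H₀ ⊆ Hl) (hHs : Hs ⊆ Hl)
    (hnice : NicelyPositioned H₁ Hs)
    (hcover : ∀ r ∈ K, StabbedBy Hl r → ¬ StabbedBy (H₁ ∪ V₁) r → StabbedBy H₀ r)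
    (hstab : StabsAll (H₁ ∪ V₁ ∪ Hs ∪ W) K) :
    ∃ Gh ⊆ components (H₁ ∪ H₀), ∃ H₁' ⊆ H₀,
      Gh.Finite ∧
      H₁.ncard + Gh.ncard + H₁'.ncard ≤ 2 * Hs.ncard ∧
      HSeparated Gh (H₁ ∪ H₁') ∧
      ∃ sel : Set (ℝ × ℝ) → Set (ℝ × ℝ),
        (∀ Q ∈ Gh, sel Q ∈ Hs ∧ sel Q ⊆ Q ∧ ∀ h ∈ Hs, h ⊆ Q → h = sel Q) ∧
        StabsAll (H₁ ∪ V₁ ∪ H₁' ∪ (sel '' Gh) ∪ W) K := by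
  classical
  obtain ⟨Y1, rfl⟩ := lines_eq H₁ (hHlfin.subset hH₁) (fun l h => hHl l (hH₁ h))
  obtain ⟨Y0, rfl⟩ := lines_eq H₀ (hHlfin.subset hH₀) (fun l h => hHl l (hH₀ h))
  obtain ⟨S, rfl⟩ := lines_eq Hs (hHlfin.subset hHs) (fun l h => hHl l (hHs h))
  have ml : ∀ (X : Finset ℝ) (y : ℝ), hline y ∈ hline '' (X : Set ℝ) ↔ y ∈ X := by
    intro X y
    rw [hline_inj.mem_set_image]
    exact Finset.mem_coe
  obtain ⟨A, hAS, T, hTY, hcard, hA1, hA2, hA3⟩ := comb_aux Y1 Y0 S (by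
    intro y hy
    obtain ⟨z, h1, h2, h3⟩ := hnice y ((ml _ _).2 hy)
    exact ⟨z, (ml _ _).1 h1, h2, fun y' hy' => h3 y' ((ml _ _).2 hy')⟩)
  set st : ℝ → Set (ℝ × ℝ) := fun s => {q | ∀ y ∈ Y1 ∪ Y0, y ∉ Set.uIcc s q.2} with hst
  have hself : ∀ s ∈ A, hline s ⊆ st s := by
    intro s hs q hq y hy hyI
    have hq : q.2 = s := hq
    rw [hq, Set.uIcc_self] at hyI
    have hyI : y = s := hyI
    subst hyI
    rcases Finset.mem_union.1 hy with k | k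
    · exact (hA1 y hs).1 k
    · exact (hA1 y hs).2.1 k
  have huniq : ∀ s ∈ A, ∀ s' ∈ S, hline s' ⊆ st s → s' = s := by
    intro s hs s' hs' hsub
    exact (hA1 s hs).2.2 s' hs' (hsub (show ((0 : ℝ), s') ∈ hline s' from rfl))
  have hinj : Set.InjOn st (A : Set ℝ) := by
    intro s hs s' hs' he
    exact huniq s' hs' s (hAS hs) (he ▸ hself s hs)
  have hsep : ∀ s ∈ A, ∀ s' ∈ A, s < s' → ∃ l ∈ hline '' (Y1 : Set ℝ) ∪ hline '' (T : Set ℝ),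
      ∃ y : ℝ, l = hline y ∧ (∀ p ∈ st s, p.2 < y) ∧ (∀ p ∈ st s', y < p.2) := by
    intro s hs s' hs' hlt
    obtain ⟨y, hy, h1, h2⟩ := hA2 s hs s' hs' hlt
    have hyY : y ∈ Y1 ∪ Y0 := by
      rcases hy with k | k
      · exact Finset.mem_union_left _ k
      · exact Finset.mem_union_right _ (hTY k)
    refine ⟨hline y, ?_, y, rfl, ?_, ?_⟩
    · rcases hy with k | k
      · exact Or.inl ((ml _ _).2 k)
      · exact Or.inr ((ml _ _).2 k)
    · intro p hp
      by_contra hc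
      exact hp y hyY (Set.mem_uIcc.2 (Or.inl ⟨h1.le, not_lt.1 hc⟩))
    · intro p hp
      by_contra hc
      exact hp y hyY (Set.mem_uIcc.2 (Or.inr ⟨not_lt.1 hc, h2.le⟩))
  refine ⟨st '' (A : Set ℝ), ?_, hline '' (T : Set ℝ), ?_, A.finite_toSet.image _, ?_, ⟨?_, ?_⟩,
    fun Q => hline (Function.invFunOn st (A : Set ℝ) Q), ?_, ?_⟩
  · rintro _ ⟨s, hs, rfl⟩
    have hsY : s ∉ ((Y1 : Set ℝ) ∪ (Y0 : Set ℝ)) := by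
      rintro (k | k)
      · exact (hA1 s hs).1 k
      · exact (hA1 s hs).2.1 k
    refine ⟨(0, s), ?_, ?_⟩
    · rw [← Set.image_union]
      intro hm
      simp only [Set.mem_iUnion, exists_prop] at hm
      obtain ⟨_, ⟨y, hy, rfl⟩, hq⟩ := hm
      have hq : s = y := hq
      exact hsY (hq ▸ hy)
    · rw [← Set.image_union, comp_eq _ _ hsY]
      ext q
      simp [hst]
  · exact Set.image_mono (by exact_mod_cast hTY)
  · rw [Set.ncard_image_of_injective _ hline_inj, Set.ncard_image_of_injective _ hline_inj,
      Set.ncard_image_of_injective _ hline_inj, hinj.ncard_image]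
    simpa [Set.ncard_coe_finset] using hcard
  · rintro _ ⟨s, hs, rfl⟩ _ ⟨s', hs', rfl⟩ hne
    have hne' : s ≠ s' := fun h => hne (h ▸ rfl)
    rcases lt_or_gt_of_ne hne' with h | h
    · obtain ⟨l, hl, y, h1, h2⟩ := hsep s hs s' hs' h
      exact ⟨l, hl, y, h1, Or.inl h2⟩
    · obtain ⟨l, hl, y, h1, h2⟩ := hsep s' hs' s hs h
      exact ⟨l, hl, y, h1, Or.inr h2⟩
  · rintro _ ⟨s, hs, rfl⟩ l hl
    have : ∃ y ∈ Y1 ∪ Y0, l = hline y := by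
      rcases hl with ⟨y, hy, rfl⟩ | ⟨y, hy, rfl⟩
      · exact ⟨y, Finset.mem_union_left _ hy, rfl⟩
      · exact ⟨y, Finset.mem_union_right _ (hTY hy), rfl⟩
    obtain ⟨y, hy, rfl⟩ := this
    rw [Set.eq_empty_iff_forall_notMem]
    rintro q ⟨hq, hqy⟩
    have hqy : q.2 = y := hqy
    exact hq y hy (hqy ▸ Set.right_mem_uIcc)
  · rintro _ ⟨s, hs, rfl⟩
    have : Function.invFunOn st (A : Set ℝ) (st s) = s := hinj.leftInvOn_invFunOn hs
    simp only [this]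
    refine ⟨(ml _ _).2 (hAS hs), hself s hs, ?_⟩
    rintro _ ⟨s', hs', rfl⟩ hsub
    rw [huniq s hs s' hs' hsub]
  · intro r hr
    by_cases hst1 : StabbedBy (hline '' (Y1 : Set ℝ) ∪ V₁) r
    · obtain ⟨l, hl, h⟩ := hst1
      exact ⟨l, Or.inl (Or.inl (Or.inl hl)), h⟩
    obtain ⟨l, hl, h⟩ := hstab r hr
    rcases hl with (hl | hl) | hl
    · exact absurd ⟨l, hl, h⟩ hst1
    · obtain ⟨l', hl', h'⟩ := hcover r hr ⟨l, hHs hl, h⟩ hst1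
      obtain ⟨a, b, c, d, hab, hcd, hre⟩ := hKrect r hr
      obtain ⟨s, hs, rfl⟩ := hl
      obtain ⟨t, ht, rfl⟩ := hl'
      rw [stab_hline hab hre] at h h'
      obtain ⟨y, hy, hyI⟩ := hA3 c d s hs t ht h h' (fun y hy hyI =>
        hst1 ⟨hline y, Or.inl ((ml _ _).2 hy), (stab_hline hab hre).2 hyI⟩)
      refine ⟨hline y, ?_, (stab_hline hab hre).2 hyI⟩
      rcases hy with k | k
      · exact Or.inl (Or.inl (Or.inr ((ml _ _).2 k)))
      · refine Or.inl (Or.inr ⟨st y, ⟨y, k, rfl⟩, ?_⟩)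
        have : Function.invFunOn st (A : Set ℝ) (st y) = y := hinj.leftInvOn_invFunOn k
        simp only [this]
    · exact ⟨l, Or.inr hl, h⟩
end
end

section
/- If G contains a multicolored clique of size k, then there exist a set 𝓗 of horizontal lines and a set 𝓥 of vertical lines, all at integer positions, such that |𝓗 ∪ 𝓥| = 4k and 𝓗 ∪ 𝓥 stabs 𝓡 = 𝓡_F ∪ 𝓡_A ∪ 𝓡_E. -/
open Set MeasureTheory

noncomputable section

/-- The closed vertical strip `ζ_v^x = [2r+xr+1, 2r+xr+r] × ℝ`. -/
def zetaV (r x : ℕ) : Set (ℝ × ℝ) :=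
  {p : ℝ × ℝ | 2*(r:ℝ) + (x:ℝ)*(r:ℝ) + 1 ≤ p.1 ∧ p.1 ≤ 2*(r:ℝ) + (x:ℝ)*(r:ℝ) + (r:ℝ)}

/-- The closed horizontal strip `ζ_h^x = ℝ × [2r+xr+1, 2r+xr+r]`. -/
def zetaH (r x : ℕ) : Set (ℝ × ℝ) :=
  {p : ℝ × ℝ | 2*(r:ℝ) + (x:ℝ)*(r:ℝ) + 1 ≤ p.2 ∧ p.2 ≤ 2*(r:ℝ) + (x:ℝ)*(r:ℝ) + (r:ℝ)}

/-- The family `𝓡_F` of forcing rectangles. -/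
def RF (k r : ℕ) : Set (Set (ℝ × ℝ)) :=
  {R | ∃ x : ℕ, x < 2*k ∧ ∃ q : ℤ, -(5*(k:ℤ)) ≤ q ∧ q ≤ -1 ∧
    (R = rect (2*(r:ℝ) + (x:ℝ)*(r:ℝ) + 1) (2*(r:ℝ) + (x:ℝ)*(r:ℝ) + (r:ℝ)) (q:ℝ) (q:ℝ) ∨
     R = rect (q:ℝ) (q:ℝ) (2*(r:ℝ) + (x:ℝ)*(r:ℝ) + 1) (2*(r:ℝ) + (x:ℝ)*(r:ℝ) + (r:ℝ)))}

/-- The adjacency rectangle `A^{i,j}_{p,q}` (with real parameters `I = i`, `J = j`,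
`P = p`, `Q = q`). -/
def Arect (r I J P Q : ℝ) : Set (ℝ × ℝ) :=
  rect (2*I*r + P + 1) (2*I*r + r + P - 1) (2*J*r + Q + 1) (2*J*r + r + Q - 1)

/-- The "top-left" equality rectangle `TL^{x,y}_a`. -/
def TLrect (r X Y A : ℝ) : Set (ℝ × ℝ) :=
  rect (2*r + X*r + 1) (2*r + X*r + A - 1) (2*r + Y*r + A) (2*r + Y*r + r)

/-- The "bottom-right" equality rectangle `BR^{x,y}_a`. -/
def BRrect (r X Y A : ℝ) : Set (ℝ × ℝ) :=
  rect (2*r + X*r + A) (2*r + X*r + r) (2*r + Y*r + 1) (2*r + Y*r + A - 1)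

/-- The family `𝓡_A` encoding non-adjacency; vertex `v^i_p` is `(i-1, p-1) : Fin k × Fin r`. -/
def RA (k r : ℕ) (G : SimpleGraph (Fin k × Fin r)) : Set (Set (ℝ × ℝ)) :=
  {R | ∃ i j : Fin k, i ≠ j ∧ ∃ p q : Fin r, ¬ G.Adj (i, p) (j, q) ∧
    R = Arect (r:ℝ) ((i:ℕ)+1 : ℝ) ((j:ℕ)+1 : ℝ) ((p:ℕ)+1 : ℝ) ((q:ℕ)+1 : ℝ)}

/-- The family `𝓡_E` of equality rectangles. -/
def RE (k r : ℕ) : Set (Set (ℝ × ℝ)) :=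
  {R | ∃ x y : ℕ, x < 2*k ∧ y < 2*k ∧ x / 2 = y / 2 ∧ ∃ a : ℕ, 2 ≤ a ∧ a ≤ r ∧
    (R = TLrect (r:ℝ) (x:ℝ) (y:ℝ) (a:ℝ) ∨ R = BRrect (r:ℝ) (x:ℝ) (y:ℝ) (a:ℝ))}

/-- A multicolored clique: a clique meeting each color class `{i} × Fin r` at most once. -/
def IsMulticoloredClique {k r : ℕ} (G : SimpleGraph (Fin k × Fin r))
    (C : Finset (Fin k × Fin r)) : Prop :=
  G.IsClique (C : Set (Fin k × Fin r)) ∧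
  ∀ u ∈ C, ∀ w ∈ C, u.1 = w.1 → u = w

theorem aux_mem_v {a b c d x : ℝ} (h1 : a ≤ x) (h2 : x ≤ b) (h3 : c ≤ d) :
    Stabs (vline x) (rect a b c d) :=
  ⟨(x, c), ⟨⟨h1, h2⟩, ⟨le_refl _, h3⟩⟩, rfl⟩

theorem aux_mem_h {a b c d y : ℝ} (h1 : c ≤ y) (h2 : y ≤ d) (h3 : a ≤ b) :
    Stabs (hline y) (rect a b c d) :=
  ⟨(a, y), ⟨⟨le_refl _, h3⟩, ⟨h1, h2⟩⟩, rfl⟩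

theorem aux_h_inj {a b : ℝ} (h : hline a = hline b) : a = b := by
  have : ((0 : ℝ), a) ∈ hline b := by rw [← h]; rfl
  exact this

theorem aux_v_inj {a b : ℝ} (h : vline a = vline b) : a = b := by
  have : (a, (0 : ℝ)) ∈ vline b := by rw [← h]; rfl
  exact this

theorem aux_h_ne_v {a b : ℝ} (h : hline a = vline b) : False := by
  have : (b + 1, a) ∈ vline b := by rw [← h]; rfl
  have h2 : b + 1 = b := this
  linarith

theorem aux_choice (k r : ℕ) (hr : 2 ≤ r)
    (G : SimpleGraph (Fin k × Fin r))
    (C : Finset (Fin k × Fin r))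
    (hC : IsMulticoloredClique G C) (hCcard : C.card = k) :
    ∃ c : ℕ → ℕ, (∀ n, c n < r) ∧
      ∀ (i : Fin k) (p : Fin r), (p : ℕ) = c i → (i, p) ∈ C := by
  have himg : C.image Prod.fst = Finset.univ := by
    apply Finset.eq_univ_of_card
    rw [Finset.card_image_of_injOn, hCcard, Fintype.card_fin]
    intro u hu w hw h
    exact hC.2 u hu w hw h
  have hex : ∀ i : Fin k, ∃ p : Fin r, (i, p) ∈ C := by
    intro i
    have : i ∈ C.image Prod.fst := by rw [himg]; exact Finset.mem_univ _
    obtain ⟨⟨a, b⟩, h1, h2⟩ := Finset.mem_image.1 this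
    exact ⟨b, by simpa [← h2] using h1⟩
  choose f hf using hex
  refine ⟨fun n => if h : n < k then (f ⟨n, h⟩ : ℕ) else 0, ?_, ?_⟩
  · intro n
    dsimp only
    split_ifs
    · exact Fin.is_lt _
    · omega
  · intro i p h
    simp only [Fin.is_lt, dite_true, Fin.eta] at h
    rw [Fin.ext h]
    exact hf i

theorem stmt7 (k r : ℕ) (hk : 1 ≤ k) (hr : 2 ≤ r)
    (G : SimpleGraph (Fin k × Fin r))
    (C : Finset (Fin k × Fin r))
    (hC : IsMulticoloredClique G C) (hCcard : C.card = k) :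
    ∃ H V : Set (Set (ℝ × ℝ)),
      (∀ l ∈ H, ∃ y : ℤ, l = hline (y : ℝ)) ∧
      (∀ l ∈ V, ∃ x : ℤ, l = vline (x : ℝ)) ∧
      (H ∪ V).Finite ∧ (H ∪ V).ncard = 4 * k ∧
      StabsAll (H ∪ V) (RF k r ∪ RA k r G ∪ RE k r) := by
  obtain ⟨c, hcr, hcC⟩ := aux_choice k r hr G C hC hCcard
  obtain ⟨pos, hpos⟩ : ∃ pos : ℕ → ℤ,
      ∀ x, pos x = 2 * (r : ℤ) + x * r + (c (x / 2) + 1) := ⟨_, fun _ => rfl⟩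
  have hposR : ∀ x, ((pos x : ℤ) : ℝ) = 2 * (r : ℝ) + x * r + (c (x / 2) + 1) := by
    intro x; rw [hpos]; push_cast; ring
  have hinj : Function.Injective pos := by
    have key : ∀ x y : ℕ, x < y → pos x < pos y := by
      intro x y h
      rw [hpos, hpos]
      have h1 := hcr (x / 2)
      have h2 : ((x : ℤ) + 1) * r ≤ y * r := by
        apply mul_le_mul_of_nonneg_right <;> omega
      have h3 : (c (x / 2) : ℤ) < r := by exact_mod_cast h1
      have h4 : (0 : ℤ) ≤ c (y / 2) := by positivity
      linarith
    exact (show StrictMono pos from fun x y h => key x y h).injective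
  have hci : ∀ n, (c n : ℝ) + 1 ≤ r := fun n => by exact_mod_cast hcr n
  have hc0 : ∀ n, (0 : ℝ) ≤ c n := fun n => by positivity
  have hr2 : (2 : ℝ) ≤ r := by exact_mod_cast hr
  have hHf : ((fun x : ℕ => hline (pos x : ℝ)) '' Set.Iio (2 * k)).Finite :=
    (Set.finite_Iio _).image _
  have hVf : ((fun x : ℕ => vline (pos x : ℝ)) '' Set.Iio (2 * k)).Finite :=
    (Set.finite_Iio _).image _
  refine ⟨(fun x : ℕ => hline (pos x : ℝ)) '' Set.Iio (2 * k),
    (fun x : ℕ => vline (pos x : ℝ)) '' Set.Iio (2 * k), ?_, ?_, hHf.union hVf, ?_, ?_⟩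
  · rintro l ⟨x, -, rfl⟩
    exact ⟨pos x, rfl⟩
  · rintro l ⟨x, -, rfl⟩
    exact ⟨pos x, rfl⟩
  · rw [Set.ncard_union_eq _ hHf hVf, Set.ncard_image_of_injective, Set.ncard_image_of_injective]
    · have : (Set.Iio (2 * k)).ncard = 2 * k := by
        rw [← Finset.coe_Iio, Set.ncard_coe_finset, Nat.card_Iio]
      omega
    · intro x y h
      exact hinj (by exact_mod_cast aux_v_inj h)
    · intro x y h
      exact hinj (by exact_mod_cast aux_h_inj h)
    · rw [Set.disjoint_left]
      rintro l ⟨x, -, rfl⟩ ⟨y, -, h⟩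
      exact aux_h_ne_v h.symm
  · have useV : ∀ x, x < 2 * k → ∀ R, Stabs (vline (pos x : ℝ)) R →
        StabbedBy ((fun x : ℕ => hline (pos x : ℝ)) '' Set.Iio (2 * k) ∪
          (fun x : ℕ => vline (pos x : ℝ)) '' Set.Iio (2 * k)) R :=
      fun x hx R h => ⟨_, Or.inr ⟨x, hx, rfl⟩, h⟩
    have useH : ∀ x, x < 2 * k → ∀ R, Stabs (hline (pos x : ℝ)) R →
        StabbedBy ((fun x : ℕ => hline (pos x : ℝ)) '' Set.Iio (2 * k) ∪
          (fun x : ℕ => vline (pos x : ℝ)) '' Set.Iio (2 * k)) R :=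
      fun x hx R h => ⟨_, Or.inl ⟨x, hx, rfl⟩, h⟩
    -- a coordinate missed by both lines of class `i` equals the chosen vertex
    have cover : ∀ (i : Fin k) (p : Fin r), (p : ℕ) ≠ c i → ∃ x, x < 2 * k ∧
        2 * ((i : ℕ) + 1 : ℝ) * r + ((p : ℕ) + 1 : ℝ) + 1 ≤ (pos x : ℝ) ∧
        (pos x : ℝ) ≤ 2 * ((i : ℕ) + 1 : ℝ) * r + r + ((p : ℕ) + 1 : ℝ) - 1 := by
      intro i p hne
      have hi := i.is_lt
      have hp0 : (0 : ℝ) ≤ (p : ℕ) := by positivity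
      have hpr : ((p : ℕ) : ℝ) + 1 ≤ r := by exact_mod_cast p.is_lt
      have h1 := hci i
      have h2 := hc0 i
      rcases lt_or_gt_of_ne hne with h | h
      · refine ⟨2 * i, by omega, ?_⟩
        have e : 2 * (i : ℕ) / 2 = i := by omega
        have h' : ((p : ℕ) : ℝ) + 1 ≤ c i := by exact_mod_cast h
        rw [hposR, e]
        push_cast
        constructor <;> linarith
      · refine ⟨2 * i + 1, by omega, ?_⟩
        have e : (2 * (i : ℕ) + 1) / 2 = i := by omega
        have h' : (c i : ℝ) + 1 ≤ (p : ℕ) := by exact_mod_cast h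
        rw [hposR, e]
        push_cast
        constructor <;> linarith
    rintro R ((⟨x, hx, q, -, -, rfl | rfl⟩ | ⟨i, j, hij, p, q, hadj, rfl⟩) |
      ⟨x, y, hx, hy, hxy, a, ha2, har, rfl | rfl⟩)
    · have h1 := hci (x / 2)
      have h2 := hc0 (x / 2)
      refine useV x hx _ (aux_mem_v ?_ ?_ le_rfl) <;> rw [hposR] <;> linarith
    · have h1 := hci (x / 2)
      have h2 := hc0 (x / 2)
      refine useH x hx _ (aux_mem_h ?_ ?_ le_rfl) <;> rw [hposR] <;> linarith
    · by_cases hp : (p : ℕ) = c i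
      · by_cases hq : (q : ℕ) = c j
        · exact absurd (hC.1 (hcC i p hp) (hcC j q hq)
            (fun h => hij (congrArg Prod.fst h))) hadj
        · obtain ⟨x, hx, h1, h2⟩ := cover j q hq
          exact useH x hx _ (aux_mem_h h1 h2 (by linarith))
      · obtain ⟨x, hx, h1, h2⟩ := cover i p hp
        exact useV x hx _ (aux_mem_v h1 h2 (by linarith))
    · have h1 := hci (x / 2)
      have h2 := hc0 (x / 2)
      have ha2' : (2 : ℝ) ≤ a := by exact_mod_cast ha2
      have har' : (a : ℝ) ≤ r := by exact_mod_cast har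
      rcases Nat.lt_or_ge (c (x / 2) + 1) a with h | h
      · have h' : (c (x / 2) : ℝ) + 1 + 1 ≤ a := by exact_mod_cast h
        refine useV x hx _ (aux_mem_v ?_ ?_ ?_) <;> (try rw [hposR]) <;> linarith
      · have h' : (a : ℝ) ≤ c (x / 2) + 1 := by exact_mod_cast h
        refine useH y hy _ (aux_mem_h ?_ ?_ ?_) <;> (try rw [hposR, ← hxy]) <;> linarith
    · have h1 := hci (x / 2)
      have h2 := hc0 (x / 2)
      have ha2' : (2 : ℝ) ≤ a := by exact_mod_cast ha2
      have har' : (a : ℝ) ≤ r := by exact_mod_cast har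
      rcases Nat.lt_or_ge (c (x / 2) + 1) a with h | h
      · have h' : (c (x / 2) : ℝ) + 1 + 1 ≤ a := by exact_mod_cast h
        refine useH y hy _ (aux_mem_h ?_ ?_ ?_) <;> (try rw [hposR, ← hxy]) <;> linarith
      · have h' : (a : ℝ) ≤ c (x / 2) + 1 := by exact_mod_cast h
        refine useV x hx _ (aux_mem_v ?_ ?_ ?_) <;> (try rw [hposR]) <;> linarith
end
end

section
/- Let ε > 0 be a real number. If 𝓗 is a finite set of horizontal lines and 𝓥 a finite set of vertical lines, all at integer positions, such that |𝓗 ∪ 𝓥| ≤ 5k − εk and 𝓗 ∪ 𝓥 stabs 𝓡 = 𝓡_F ∪ 𝓡_A ∪ 𝓡_E, then G contains a multicolored clique C with |C| ≥ εk. -/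
open Set MeasureTheory

noncomputable section

lemma stab_cases (H V : Set (Set (ℝ × ℝ)))
    (hH : ∀ l ∈ H, ∃ y : ℤ, l = hline (y : ℝ))
    (hV : ∀ l ∈ V, ∃ x : ℤ, l = vline (x : ℝ)) (a b c d : ℤ) (R : Set (ℝ × ℝ))
    (hR : R = rect (a:ℝ) b c d)
    (h : StabbedBy (H ∪ V) R) :
    (∃ x : ℤ, vline (x:ℝ) ∈ H ∪ V ∧ a ≤ x ∧ x ≤ b) ∨
    (∃ y : ℤ, hline (y:ℝ) ∈ H ∪ V ∧ c ≤ y ∧ y ≤ d) := by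
  subst hR
  obtain ⟨l, hl, ⟨p1, p2⟩, hp, hpl⟩ := h
  obtain ⟨⟨h1, h2⟩, h3, h4⟩ := hp
  simp only at h1 h2 h3 h4
  rcases hl with hl' | hl'
  · obtain ⟨y, rfl⟩ := hH l hl'
    have : p2 = y := hpl
    subst this
    exact Or.inr ⟨y, Or.inl hl', by exact_mod_cast h3, by exact_mod_cast h4⟩
  · obtain ⟨y, rfl⟩ := hV l hl'
    have : p1 = y := hpl
    subst this
    exact Or.inl ⟨y, Or.inr hl', by exact_mod_cast h1, by exact_mod_cast h2⟩

def strip (r : ℕ) (Z : Finset ℤ) (x : ℕ) : Finset ℤ :=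
  Z.filter (fun z => 2*(r:ℤ) + x*r + 1 ≤ z ∧ z ≤ 2*(r:ℤ) + x*r + r)

lemma mem_strip {r : ℕ} {Z : Finset ℤ} {x : ℕ} {z : ℤ} :
    z ∈ strip r Z x ↔ z ∈ Z ∧ 2*(r:ℤ) + x*r + 1 ≤ z ∧ z ≤ 2*(r:ℤ) + x*r + r := by
  simp [strip]

lemma strip_sum (r : ℕ) (Z : Finset ℤ) (n : ℕ) :
    ∑ x ∈ Finset.range n, (strip r Z x).card ≤ Z.card := by
  rw [← Finset.card_biUnion]
  · apply Finset.card_le_card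
    intro z hz
    rw [Finset.mem_biUnion] at hz
    obtain ⟨x, _, hz⟩ := hz
    exact (mem_strip.1 hz).1
  · have key : ∀ x y : ℕ, x < y → Disjoint (strip r Z x) (strip r Z y) := by
      intro x y hxy
      rw [Finset.disjoint_left]
      intro z h1 h2
      have h1 := (mem_strip.1 h1).2.2
      have h2 := (mem_strip.1 h2).2.1
      have : ((x:ℤ)+1) * r ≤ y * r :=
        mul_le_mul_of_nonneg_right (by exact_mod_cast hxy) (by positivity)
      linarith
    intro x _ y _ hne
    rcases lt_or_gt_of_ne hne with h | h
    · exact key x y h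
    · exact (key y x h).symm

lemma sum_two (f : ℕ → ℕ) (k : ℕ) :
    ∑ x ∈ Finset.range (2*k), f x = ∑ i ∈ Finset.range k, (f (2*i) + f (2*i+1)) := by
  induction k with
  | zero => simp
  | succ n ih =>
    rw [Finset.sum_range_succ, ← ih, show 2*(n+1) = 2*n+1+1 by ring, Finset.sum_range_succ,
      Finset.sum_range_succ]
    ring

lemma abstract_main (k r : ℕ) (hr : 2 ≤ r) (G : SimpleGraph (Fin k × Fin r)) (X Y : Finset ℤ)
    (hlt : X.card + Y.card < 5 * k)
    (hF1 : ∀ x : ℕ, x < 2*k → ∀ q : ℤ, -(5*(k:ℤ)) ≤ q → q ≤ -1 →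
      (∃ u ∈ X, 2*(r:ℤ) + x*r + 1 ≤ u ∧ u ≤ 2*(r:ℤ) + x*r + r) ∨ q ∈ Y)
    (hF2 : ∀ x : ℕ, x < 2*k → ∀ q : ℤ, -(5*(k:ℤ)) ≤ q → q ≤ -1 →
      q ∈ X ∨ (∃ u ∈ Y, 2*(r:ℤ) + x*r + 1 ≤ u ∧ u ≤ 2*(r:ℤ) + x*r + r))
    (hTL : ∀ x y : ℕ, x < 2*k → y < 2*k → x/2 = y/2 → ∀ a : ℕ, 2 ≤ a → a ≤ r →
      (∃ u ∈ X, 2*(r:ℤ) + x*r + 1 ≤ u ∧ u ≤ 2*(r:ℤ) + x*r + a - 1) ∨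
      (∃ u ∈ Y, 2*(r:ℤ) + y*r + a ≤ u ∧ u ≤ 2*(r:ℤ) + y*r + r))
    (hBR : ∀ x y : ℕ, x < 2*k → y < 2*k → x/2 = y/2 → ∀ a : ℕ, 2 ≤ a → a ≤ r →
      (∃ u ∈ X, 2*(r:ℤ) + x*r + a ≤ u ∧ u ≤ 2*(r:ℤ) + x*r + r) ∨
      (∃ u ∈ Y, 2*(r:ℤ) + y*r + 1 ≤ u ∧ u ≤ 2*(r:ℤ) + y*r + a - 1))
    (hA : ∀ i j : Fin k, i ≠ j → ∀ p q : Fin r, ¬ G.Adj (i, p) (j, q) →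
      (∃ u ∈ X, 2*((i:ℕ)+1:ℤ)*r + ((p:ℕ)+1) + 1 ≤ u ∧ u ≤ 2*((i:ℕ)+1:ℤ)*r + r + ((p:ℕ)+1) - 1) ∨
      (∃ u ∈ Y, 2*((j:ℕ)+1:ℤ)*r + ((q:ℕ)+1) + 1 ≤ u ∧ u ≤ 2*((j:ℕ)+1:ℤ)*r + r + ((q:ℕ)+1) - 1)) :
    ∃ C : Finset (Fin k × Fin r), IsMulticoloredClique G C ∧ 5 * k ≤ X.card + Y.card + C.card := by
  have hcardq : (Finset.Icc (-(5*(k:ℤ))) (-1)).card = 5 * k := by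
    simp
    omega
  have hX1 : ∀ x < 2*k, 1 ≤ (strip r X x).card := by
    intro x hx
    rw [Finset.one_le_card]
    by_contra hne
    rw [Finset.not_nonempty_iff_eq_empty] at hne
    have : Finset.Icc (-(5*(k:ℤ))) (-1) ⊆ Y := by
      intro q hq
      rw [Finset.mem_Icc] at hq
      rcases hF1 x hx q hq.1 hq.2 with ⟨u, hu, h⟩ | h
      · have := mem_strip.2 ⟨hu, h⟩
        rw [hne] at this
        simp at this
      · exact h
    have := Finset.card_le_card this
    omega
  have hY1 : ∀ x < 2*k, 1 ≤ (strip r Y x).card := by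
    intro x hx
    rw [Finset.one_le_card]
    by_contra hne
    rw [Finset.not_nonempty_iff_eq_empty] at hne
    have : Finset.Icc (-(5*(k:ℤ))) (-1) ⊆ X := by
      intro q hq
      rw [Finset.mem_Icc] at hq
      rcases hF2 x hx q hq.1 hq.2 with h | ⟨u, hu, h⟩
      · exact h
      · have := mem_strip.2 ⟨hu, h⟩
        rw [hne] at this
        simp at this
    have := Finset.card_le_card this
    omega
  set f : ℕ → ℕ := fun x => (strip r X x).card + (strip r Y x).card with hf
  have hsum : ∑ i : Fin k, (f (2*i) + f (2*i+1)) ≤ X.card + Y.card := by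
    rw [Fin.sum_univ_eq_sum_range (fun i => f (2*i) + f (2*i+1)), ← sum_two, hf,
      Finset.sum_add_distrib]
    exact add_le_add (strip_sum _ _ _) (strip_sum _ _ _)
  set good : Finset (Fin k) := Finset.univ.filter (fun i : Fin k => f (2*i) + f (2*i+1) ≤ 4) with hgood
  have hgc : 5 * k ≤ X.card + Y.card + good.card := by
    have h1 : ∑ i : Fin k, 5 ≤ ∑ i : Fin k,
        ((f (2*i) + f (2*i+1)) + if f (2*i) + f (2*i+1) ≤ 4 then 1 else 0) := by
      apply Finset.sum_le_sum
      intro i _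
      have a1 := hX1 (2*i) (by omega)
      have a2 := hX1 (2*i+1) (by omega)
      have a3 := hY1 (2*i) (by omega)
      have a4 := hY1 (2*i+1) (by omega)
      simp only [hf]
      split_ifs <;> omega
    rw [Finset.sum_add_distrib, ← Finset.card_filter] at h1
    simp only [Finset.sum_const, Finset.card_univ, Fintype.card_fin, smul_eq_mul] at h1
    rw [← hgood] at h1
    omega
  -- uniqueness
  have hP : ∀ i : Fin k, i ∈ good → ∃ p : Fin r, ∀ e : ℕ, e < 2 →
      (∀ u ∈ X, 2*(r:ℤ) + (2*i+e : ℕ)*r + 1 ≤ u → u ≤ 2*(r:ℤ) + (2*i+e : ℕ)*r + r →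
        u = 2*(r:ℤ) + (2*i+e : ℕ)*r + ((p:ℕ) + 1)) ∧
      (∀ u ∈ Y, 2*(r:ℤ) + (2*i+e : ℕ)*r + 1 ≤ u → u ≤ 2*(r:ℤ) + (2*i+e : ℕ)*r + r →
        u = 2*(r:ℤ) + (2*i+e : ℕ)*r + ((p:ℕ) + 1)) := by
    intro i hi
    have hi4 : f (2*i) + f (2*i+1) ≤ 4 := (Finset.mem_filter.1 hi).2
    have a1 := hX1 (2*i) (by omega)
    have a2 := hX1 (2*i+1) (by omega)
    have a3 := hY1 (2*i) (by omega)
    have a4 := hY1 (2*i+1) (by omega)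
    simp only [hf] at hi4
    have cX : ∀ e < 2, ∃ α : ℤ, strip r X (2*i+e) = {2*(r:ℤ) + (2*i+e : ℕ)*r + α} := by
      intro e he
      have : (strip r X (2*i+e)).card = 1 := by
        rcases (show e = 0 ∨ e = 1 by omega) with rfl | rfl
        · rw [add_zero]; omega
        · omega
      obtain ⟨a, ha⟩ := Finset.card_eq_one.1 this
      exact ⟨a - (2*(r:ℤ) + (2*i+e : ℕ)*r), by rw [ha]; congr 1; ring⟩
    have cY : ∀ e < 2, ∃ α : ℤ, strip r Y (2*i+e) = {2*(r:ℤ) + (2*i+e : ℕ)*r + α} := by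
      intro e he
      have : (strip r Y (2*i+e)).card = 1 := by
        rcases (show e = 0 ∨ e = 1 by omega) with rfl | rfl
        · rw [add_zero]; omega
        · omega
      obtain ⟨a, ha⟩ := Finset.card_eq_one.1 this
      exact ⟨a - (2*(r:ℤ) + (2*i+e : ℕ)*r), by rw [ha]; congr 1; ring⟩
    have rng : ∀ (Z : Finset ℤ) (x : ℕ) (α : ℤ), strip r Z x = {2*(r:ℤ) + x*r + α} →
        1 ≤ α ∧ α ≤ r := by
      intro Z x α h
      have : 2*(r:ℤ) + x*r + α ∈ strip r Z x := by rw [h]; simp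
      have := (mem_strip.1 this).2
      constructor <;> linarith [this.1, this.2]
    have uniq : ∀ (Z : Finset ℤ) (x : ℕ) (α : ℤ), strip r Z x = {2*(r:ℤ) + x*r + α} →
        ∀ u ∈ Z, 2*(r:ℤ) + x*r + 1 ≤ u → u ≤ 2*(r:ℤ) + x*r + r → u = 2*(r:ℤ) + x*r + α := by
      intro Z x α h u hu h1 h2
      have : u ∈ strip r Z x := mem_strip.2 ⟨hu, h1, h2⟩
      rw [h] at this
      simpa using this
    have eqv : ∀ e < 2, ∀ e' < 2, ∀ α β : ℤ, strip r X (2*i+e) = {2*(r:ℤ) + (2*i+e : ℕ)*r + α} →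
        strip r Y (2*i+e') = {2*(r:ℤ) + (2*i+e' : ℕ)*r + β} → α = β := by
      intro e he e' he' α β hα hβ
      have r1 := rng _ _ _ hα
      have r2 := rng _ _ _ hβ
      have u1 := uniq _ _ _ hα
      have u2 := uniq _ _ _ hβ
      have hx : 2*(i:ℕ)+e < 2*k := by omega
      have hy : 2*(i:ℕ)+e' < 2*k := by omega
      have hxy : (2*(i:ℕ)+e)/2 = (2*(i:ℕ)+e')/2 := by omega
      rcases lt_trichotomy α β with h | h | h
      · exfalso
        have hb : ((β.toNat : ℕ) : ℤ) = β := Int.toNat_of_nonneg (by omega)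
        rcases hBR _ _ hx hy hxy β.toNat (by omega) (by omega) with ⟨u, hu, h1, h2⟩ | ⟨u, hu, h1, h2⟩
        · rw [hb] at h1
          have := u1 u hu (by linarith) (by linarith)
          linarith
        · rw [hb] at h2
          have := u2 u hu (by linarith) (by linarith)
          linarith
      · exact h
      · exfalso
        have hb : ((α.toNat : ℕ) : ℤ) = α := Int.toNat_of_nonneg (by omega)
        rcases hTL _ _ hx hy hxy α.toNat (by omega) (by omega) with ⟨u, hu, h1, h2⟩ | ⟨u, hu, h1, h2⟩
        · rw [hb] at h2
          have := u1 u hu (by linarith) (by linarith)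
          linarith
        · rw [hb] at h1
          have := u2 u hu (by linarith) (by linarith)
          linarith
    obtain ⟨α, hα⟩ := cX 0 (by norm_num)
    obtain ⟨β, hβ⟩ := cY 0 (by norm_num)
    have hr1 := rng _ _ _ hα
    have hab := eqv 0 (by norm_num) 0 (by norm_num) α β hα hβ
    have hpe : (((α - 1).toNat : ℕ) : ℤ) + 1 = α := by omega
    refine ⟨⟨(α - 1).toNat, by omega⟩, ?_⟩
    intro e he
    obtain ⟨γ, hγ⟩ := cX e he
    obtain ⟨δ, hδ⟩ := cY e he
    have e1 := eqv e he 0 (by norm_num) _ _ hγ hβ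
    have e2 := eqv 0 (by norm_num) e he _ _ hα hδ
    simp only [hpe]
    constructor
    · have := uniq _ _ _ hγ
      rwa [e1, ← hab] at this
    · have := uniq _ _ _ hδ
      rwa [← e2] at this
  have : Nonempty (Fin r) := ⟨⟨0, by omega⟩⟩
  choose! p hp using hP
  refine ⟨good.image (fun i => (i, p i)), ⟨?_, ?_⟩, ?_⟩
  · have key : ∀ (Z : Finset ℤ) (i : Fin k) (m : ℕ), m < r →
        (∀ e : ℕ, e < 2 → ∀ u ∈ Z, 2*(r:ℤ) + (2*i+e : ℕ)*r + 1 ≤ u →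
          u ≤ 2*(r:ℤ) + (2*i+e : ℕ)*r + r → u = 2*(r:ℤ) + (2*i+e : ℕ)*r + ((m:ℕ) + 1)) →
        ¬ ∃ u ∈ Z, 2*((i:ℕ)+1:ℤ)*r + (m+1) + 1 ≤ u ∧ u ≤ 2*((i:ℕ)+1:ℤ)*r + r + (m+1) - 1 := by
      rintro Z i m hm h ⟨u, hu, h1, h2⟩
      have hm' : (m:ℤ) + 1 ≤ r := by exact_mod_cast hm
      have hm0 : (0:ℤ) ≤ m := by positivity
      have q0 := h 0 (by norm_num) u hu
      have q1 := h 1 (by norm_num) u hu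
      push_cast at q0 q1
      rcases le_or_gt u (2*((i:ℕ)+1:ℤ)*r + r) with hle | hgt
      · have := q0 (by linarith) (by linarith)
        linarith
      · have := q1 (by linarith) (by linarith)
        linarith
    intro a ha b hb hne
    simp only [Finset.coe_image, Set.mem_image, Finset.mem_coe] at ha hb
    obtain ⟨i, hi, rfl⟩ := ha
    obtain ⟨j, hj, rfl⟩ := hb
    have hij : i ≠ j := by rintro rfl; exact hne rfl
    by_contra hadj
    rcases hA i j hij (p i) (p j) hadj with h | h
    · exact key X i (p i) (p i).2 (fun e he => (hp i hi e he).1) h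
    · exact key Y j (p j) (p j).2 (fun e he => (hp j hj e he).2) h
  · intro u hu w hw huw
    simp only [Finset.mem_image] at hu hw
    obtain ⟨i, hi, rfl⟩ := hu
    obtain ⟨j, hj, rfl⟩ := hw
    simp only at huw
    rw [huw]
  · rw [Finset.card_image_of_injective _ (fun i j h => (Prod.ext_iff.1 h).1)]
    exact hgc

theorem stmt8 (k r : ℕ) (hk : 1 ≤ k) (hr : 2 ≤ r)
    (G : SimpleGraph (Fin k × Fin r))
    (ε : ℝ) (hε : 0 < ε)
    (H V : Set (Set (ℝ × ℝ)))
    (hH : ∀ l ∈ H, ∃ y : ℤ, l = hline (y : ℝ))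
    (hV : ∀ l ∈ V, ∃ x : ℤ, l = vline (x : ℝ))
    (hfin : (H ∪ V).Finite)
    (hcard : ((H ∪ V).ncard : ℝ) ≤ 5 * k - ε * k)
    (hstab : StabsAll (H ∪ V) (RF k r ∪ RA k r G ∪ RE k r)) :
    ∃ C : Finset (Fin k × Fin r),
      IsMulticoloredClique G C ∧ ε * k ≤ (C.card : ℝ) := by
  have hvinj : Function.Injective (fun x : ℤ => vline (x:ℝ)) := by
    intro x y h
    have : ((x:ℝ), (0:ℝ)) ∈ vline (y:ℝ) := by
      have h : vline (x:ℝ) = vline (y:ℝ) := h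
      rw [← h]; rfl
    have : (x:ℝ) = y := this
    exact_mod_cast this
  have hhinj : Function.Injective (fun x : ℤ => hline (x:ℝ)) := by
    intro x y h
    have : ((0:ℝ), (x:ℝ)) ∈ hline (y:ℝ) := by
      have h : hline (x:ℝ) = hline (y:ℝ) := h
      rw [← h]; rfl
    have : (x:ℝ) = y := this
    exact_mod_cast this
  have hXf : ((fun x : ℤ => vline (x:ℝ)) ⁻¹' (H ∪ V)).Finite := hfin.preimage hvinj.injOn
  have hYf : ((fun x : ℤ => hline (x:ℝ)) ⁻¹' (H ∪ V)).Finite := hfin.preimage hhinj.injOn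
  have mX : ∀ x : ℤ, vline (x:ℝ) ∈ H ∪ V ↔ x ∈ hXf.toFinset := by intro x; simp
  have mY : ∀ x : ℤ, hline (x:ℝ) ∈ H ∪ V ↔ x ∈ hYf.toFinset := by intro x; simp
  have hc : hXf.toFinset.card + hYf.toFinset.card ≤ (H ∪ V).ncard := by
    classical
    rw [← Finset.card_image_of_injective hXf.toFinset hvinj,
      ← Finset.card_image_of_injective hYf.toFinset hhinj, ← Finset.card_union_of_disjoint,
      ← Set.ncard_coe_finset]
    · apply Set.ncard_le_ncard _ hfin
      intro l hl
      simp only [Finset.coe_union, Finset.coe_image, Set.mem_union, Set.mem_image,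
        Finset.mem_coe] at hl
      rcases hl with ⟨x, hx, rfl⟩ | ⟨x, hx, rfl⟩
      · exact (mX x).2 hx
      · exact (mY x).2 hx
    · rw [Finset.disjoint_left]
      intro l h1 h2
      simp only [Finset.mem_image] at h1 h2
      obtain ⟨x, _, rfl⟩ := h1
      obtain ⟨y, _, h⟩ := h2
      have : ((x:ℝ), (y:ℝ)+1) ∈ hline (y:ℝ) := by rw [h]; rfl
      have : (y:ℝ) + 1 = y := this
      linarith
  have hkpos : (0:ℝ) < k := by exact_mod_cast hk
  have hlt : (H ∪ V).ncard < 5 * k := by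
    have : ((H ∪ V).ncard : ℝ) < 5 * k := by
      have := mul_pos hε hkpos
      linarith
    exact_mod_cast this
  have st := stab_cases H V hH hV
  simp only [mX, mY] at st
  generalize hXf.toFinset = X at *
  generalize hYf.toFinset = Y at *
  suffices hm : ∃ C : Finset (Fin k × Fin r), IsMulticoloredClique G C ∧
      5 * k ≤ X.card + Y.card + C.card by
    obtain ⟨C, hC, hCc⟩ := hm
    refine ⟨C, hC, ?_⟩
    have : 5 * k ≤ (H ∪ V).ncard + C.card := by omega
    have : (5:ℝ) * k ≤ (H ∪ V).ncard + C.card := by exact_mod_cast this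
    linarith
  refine abstract_main k r hr G X Y (by omega) ?_ ?_ ?_ ?_ ?_
  · intro x hx q h1 h2
    rcases st (2*(r:ℤ) + x*r + 1) (2*(r:ℤ) + x*r + r) q q _ (by push_cast; rfl)
      (hstab _ (Or.inl (Or.inl ⟨x, hx, q, h1, h2, Or.inl rfl⟩))) with h | ⟨y, hy, ha, hb⟩
    · exact Or.inl h
    · exact Or.inr (by rwa [le_antisymm ha hb])
  · intro x hx q h1 h2
    rcases st q q (2*(r:ℤ) + x*r + 1) (2*(r:ℤ) + x*r + r) _ (by push_cast; rfl)
      (hstab _ (Or.inl (Or.inl ⟨x, hx, q, h1, h2, Or.inr rfl⟩))) with ⟨y, hy, ha, hb⟩ | h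
    · exact Or.inl (by rwa [le_antisymm ha hb])
    · exact Or.inr h
  · intro x y hx hy hxy a h1 h2
    exact st _ _ _ _ _ (by push_cast; rfl)
      (hstab _ (Or.inr ⟨x, y, hx, hy, hxy, a, h1, h2, Or.inl rfl⟩))
  · intro x y hx hy hxy a h1 h2
    exact st _ _ _ _ _ (by push_cast; rfl)
      (hstab _ (Or.inr ⟨x, y, hx, hy, hxy, a, h1, h2, Or.inr rfl⟩))
  · intro i j hij p q hadj
    exact st _ _ _ _ _ (by push_cast; rfl)
      (hstab _ (Or.inl (Or.inr ⟨i, j, hij, p, q, hadj, rfl⟩)))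
end
end

section
/- Let 𝓗 be a finite set of horizontal lines and 𝓥 a finite set of vertical lines such that 𝓗 ∪ 𝓥 stabs 𝓡_F and |𝓗 ∪ 𝓥| < 5k. Then for every x ∈ {0,…,2k−1}, 𝓗 contains at least one line contained in the strip ζ_h^x, and 𝓥 contains at least one line contained in the strip ζ_v^x. -/
open Set MeasureTheory

noncomputable section

theorem aux_card (k : ℕ) (L : Set (Set (ℝ × ℝ))) (hfin : L.Finite)
    (f : ℝ → Set (ℝ × ℝ)) (hf : Function.Injective f)
    (h : ∀ q : ℤ, -(5*(k:ℤ)) ≤ q → q ≤ -1 → f (q:ℝ) ∈ L) : 5 * k ≤ L.ncard := by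
  have hinj : Function.Injective (fun q : ℤ => f (q:ℝ)) :=
    fun a b hab => Int.cast_injective (hf hab)
  have h1 : ((fun q : ℤ => f (q:ℝ)) '' (Set.Icc (-(5*(k:ℤ))) (-1))).ncard ≤ L.ncard := by
    apply Set.ncard_le_ncard _ hfin
    rintro _ ⟨q, hq, rfl⟩
    exact h q hq.1 hq.2
  rw [Set.ncard_image_of_injective _ hinj, ← Finset.coe_Icc, Set.ncard_coe_finset,
    Int.card_Icc] at h1
  omega

theorem stmt9 (k r : ℕ) (hk : 1 ≤ k) (hr : 2 ≤ r)
    (H V : Set (Set (ℝ × ℝ)))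
    (hHfin : H.Finite) (hH : IsHLineSet H)
    (hVfin : V.Finite) (hV : IsVLineSet V)
    (hstab : StabsAll (H ∪ V) (RF k r))
    (hcard : (H ∪ V).ncard < 5 * k) :
    ∀ x : ℕ, x < 2 * k →
      (∃ l ∈ H, l ⊆ zetaH r x) ∧ (∃ l ∈ V, l ⊆ zetaV r x) := by
  intro x hx
  have hfin := hHfin.union hVfin
  constructor
  · by_contra hcon
    refine absurd (aux_card k _ hfin vline vline_inj ?_) (not_le.mpr hcard)
    intro q hq1 hq2
    obtain ⟨l, hl, p, ⟨hp1, hp2⟩, hpl⟩ := hstab _ ⟨x, hx, q, hq1, hq2, Or.inr rfl⟩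
    rcases hl with hl | hl
    · exfalso
      apply hcon
      obtain ⟨y, rfl⟩ := hH l hl
      refine ⟨_, hl, fun p' hp' => ?_⟩
      have e1 : p.2 = y := hpl
      have e2 : p'.2 = y := hp'
      have e3 : p'.2 = p.2 := e2.trans e1.symm
      exact ⟨e3 ▸ hp2.1, e3 ▸ hp2.2⟩
    · obtain ⟨y, rfl⟩ := hV l hl
      have e1 : p.1 = y := hpl
      have e2 : (q:ℝ) = y := e1 ▸ le_antisymm hp1.1 hp1.2
      rw [e2]
      exact Or.inr hl
  · by_contra hcon
    refine absurd (aux_card k _ hfin hline hline_inj ?_) (not_le.mpr hcard)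
    intro q hq1 hq2
    obtain ⟨l, hl, p, ⟨hp1, hp2⟩, hpl⟩ := hstab _ ⟨x, hx, q, hq1, hq2, Or.inl rfl⟩
    rcases hl with hl | hl
    · obtain ⟨y, rfl⟩ := hH l hl
      have e1 : p.2 = y := hpl
      have e2 : (q:ℝ) = y := e1 ▸ le_antisymm hp2.1 hp2.2
      rw [e2]
      exact Or.inl hl
    · exfalso
      apply hcon
      obtain ⟨y, rfl⟩ := hV l hl
      refine ⟨_, hl, fun p' hp' => ?_⟩
      have e1 : p.1 = y := hpl
      have e2 : p'.1 = y := hp'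
      have e3 : p'.1 = p.1 := e2.trans e1.symm
      exact ⟨e3 ▸ hp1.1, e3 ▸ hp1.2⟩
end
end

section
/- Let i ∈ {1,…,k} and p, q ∈ {1,…,r}. Let 𝓗 be a set of horizontal lines and 𝓥 a set of vertical lines such that the only line of 𝓥 contained in the strip ζ_v^{2i−2} is ℓ_v^{2ir+p}, the only line of 𝓗 contained in the strip ζ_h^{2i−1} is ℓ_h^{2ir+r+q}, and 𝓗 ∪ 𝓥 stabs each of the rectangles TL^{2i−2,2i−1}_a and BR^{2i−2,2i−1}_a for every a ∈ {2,…,r}. Then p = q. -/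
open Set MeasureTheory

noncomputable section

theorem stmt10 (k r : ℕ) (hk : 1 ≤ k) (hr : 2 ≤ r)
    (i p q : ℕ) (hi : 1 ≤ i ∧ i ≤ k) (hp : 1 ≤ p ∧ p ≤ r) (hq : 1 ≤ q ∧ q ≤ r)
    (H V : Set (Set (ℝ × ℝ)))
    (hH : IsHLineSet H) (hV : IsVLineSet V)
    (hVmem : vline (2*(i:ℝ)*(r:ℝ) + (p:ℝ)) ∈ V)
    (hVuniq : ∀ l ∈ V, l ⊆ zetaV r (2*i - 2) → l = vline (2*(i:ℝ)*(r:ℝ) + (p:ℝ)))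
    (hHmem : hline (2*(i:ℝ)*(r:ℝ) + (r:ℝ) + (q:ℝ)) ∈ H)
    (hHuniq : ∀ l ∈ H, l ⊆ zetaH r (2*i - 1) → l = hline (2*(i:ℝ)*(r:ℝ) + (r:ℝ) + (q:ℝ)))
    (hstab : ∀ a : ℕ, 2 ≤ a → a ≤ r →
      StabbedBy (H ∪ V) (TLrect (r:ℝ) ((2*i - 2 : ℕ) : ℝ) ((2*i - 1 : ℕ) : ℝ) (a:ℝ)) ∧
      StabbedBy (H ∪ V) (BRrect (r:ℝ) ((2*i - 2 : ℕ) : ℝ) ((2*i - 1 : ℕ) : ℝ) (a:ℝ))) :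
    p = q := by
  obtain ⟨hi1, -⟩ := hi
  have e1 : ((2*i - 2 : ℕ) : ℝ) = 2*(i:ℝ) - 2 := by
    rw [Nat.cast_sub (by omega)]; push_cast; ring
  have e2 : ((2*i - 1 : ℕ) : ℝ) = 2*(i:ℝ) - 1 := by
    rw [Nat.cast_sub (by omega)]; push_cast; ring
  -- any line stabbing a rectangle inside the strips is one of the two given lines
  have key : ∀ a b c d : ℝ, 1 ≤ a → b ≤ r → 1 ≤ c → d ≤ r →
      StabbedBy (H ∪ V) (rect (2*(i:ℝ)*r + a) (2*(i:ℝ)*r + b)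
        (2*(i:ℝ)*r + r + c) (2*(i:ℝ)*r + r + d)) →
      (a ≤ p ∧ (p:ℝ) ≤ b) ∨ (c ≤ q ∧ (q:ℝ) ≤ d) := by
    rintro a b c d ha hb hc hd ⟨l, hl, ⟨z1, z2⟩, ⟨⟨hz1, hz1'⟩, ⟨hz2, hz2'⟩⟩, hzl⟩
    dsimp only at hz1 hz1' hz2 hz2'
    rcases hl with hl | hl
    · right
      obtain ⟨y, rfl⟩ := hH l hl
      have hy : z2 = y := hzl
      have h := hHuniq _ hl (by
        rintro ⟨w1, w2⟩ hw
        have hw' : w2 = y := hw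
        simp only [zetaH, mem_setOf_eq, e2]
        constructor <;> nlinarith)
      rw [h] at hzl
      have h3 : z2 = 2*(i:ℝ)*(r:ℝ) + (r:ℝ) + (q:ℝ) := hzl
      constructor <;> linarith
    · left
      obtain ⟨x, rfl⟩ := hV l hl
      have hx : z1 = x := hzl
      have h := hVuniq _ hl (by
        rintro ⟨w1, w2⟩ hw
        have hw' : w1 = x := hw
        simp only [zetaV, mem_setOf_eq, e1]
        constructor <;> nlinarith)
      rw [h] at hzl
      have h3 : z1 = 2*(i:ℝ)*(r:ℝ) + (p:ℝ) := hzl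
      constructor <;> linarith
  rcases lt_trichotomy p q with h | h | h
  · exfalso
    have h1 := (hstab q (by omega) hq.2).2
    have hq1 : (1:ℝ) ≤ q := by exact_mod_cast hq.1
    have hqr : (q:ℝ) ≤ r := by exact_mod_cast hq.2
    have hpq : (p:ℝ) < q := by exact_mod_cast h
    have := key q r 1 (q-1) hq1 le_rfl le_rfl (by linarith) (by
      convert h1 using 1
      rw [BRrect, e1, e2]
      congr 1 <;> ring)
    rcases this with h | h <;> linarith [h.1, h.2]
  · exact h
  · exfalso
    have h1 := (hstab p (by omega) hp.2).1
    have hp1 : (1:ℝ) ≤ p := by exact_mod_cast hp.1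
    have hpr : (p:ℝ) ≤ r := by exact_mod_cast hp.2
    have hpq : (q:ℝ) < p := by exact_mod_cast h
    have := key 1 (p-1) p r le_rfl (by linarith) hp1 le_rfl (by
      convert h1 using 1
      rw [TLrect, e1, e2]
      congr 1 <;> ring)
    rcases this with h | h <;> linarith [h.1, h.2]
end
end

section
/- Let i, j ∈ {1,…,k} with i ≠ j and p, q ∈ {1,…,r}. Let 𝓗 be a set of horizontal lines and 𝓥 a set of vertical lines, all at integer positions, such that the only line of 𝓥 contained in ζ_v^{2i−2} is ℓ_v^{2ir+p}, the only line of 𝓥 contained in ζ_v^{2i−1} is ℓ_v^{2ir+r+p}, the only line of 𝓗 contained in ζ_h^{2j−2} is ℓ_h^{2jr+q}, and the only line of 𝓗 contained in ζ_h^{2j−1} is ℓ_h^{2jr+r+q}. Then the rectangle A^{i,j}_{p,q} = [2ir+p+1, 2ir+r+p−1] × [2jr+q+1, 2jr+r+q−1] is not stabbed by any line of 𝓗 ∪ 𝓥. -/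
open Set MeasureTheory

noncomputable section

theorem stmt12 (k r : ℕ) (hk : 1 ≤ k) (hr : 2 ≤ r)
    (i j p q : ℕ) (hi : 1 ≤ i ∧ i ≤ k) (hj : 1 ≤ j ∧ j ≤ k) (hij : i ≠ j)
    (hp : 1 ≤ p ∧ p ≤ r) (hq : 1 ≤ q ∧ q ≤ r)
    (H V : Set (Set (ℝ × ℝ)))
    (hH : ∀ l ∈ H, ∃ y : ℤ, l = hline (y : ℝ))
    (hV : ∀ l ∈ V, ∃ x : ℤ, l = vline (x : ℝ))
    (hV1mem : vline (2*(i:ℝ)*(r:ℝ) + (p:ℝ)) ∈ V)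
    (hV1uniq : ∀ l ∈ V, l ⊆ zetaV r (2*i - 2) → l = vline (2*(i:ℝ)*(r:ℝ) + (p:ℝ)))
    (hV2mem : vline (2*(i:ℝ)*(r:ℝ) + (r:ℝ) + (p:ℝ)) ∈ V)
    (hV2uniq : ∀ l ∈ V, l ⊆ zetaV r (2*i - 1) → l = vline (2*(i:ℝ)*(r:ℝ) + (r:ℝ) + (p:ℝ)))
    (hH1mem : hline (2*(j:ℝ)*(r:ℝ) + (q:ℝ)) ∈ H)
    (hH1uniq : ∀ l ∈ H, l ⊆ zetaH r (2*j - 2) → l = hline (2*(j:ℝ)*(r:ℝ) + (q:ℝ)))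
    (hH2mem : hline (2*(j:ℝ)*(r:ℝ) + (r:ℝ) + (q:ℝ)) ∈ H)
    (hH2uniq : ∀ l ∈ H, l ⊆ zetaH r (2*j - 1) → l = hline (2*(j:ℝ)*(r:ℝ) + (r:ℝ) + (q:ℝ))) :
    ∀ l ∈ H ∪ V, ¬ Stabs l (Arect (r:ℝ) (i:ℝ) (j:ℝ) (p:ℝ) (q:ℝ)) := by
  rintro l hl ⟨z, hzR, hzl⟩
  rcases hl with hl | hl
  · obtain ⟨x, rfl⟩ := hH l hl
    have hx : z.2 = (x:ℝ) := hzl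
    have h1 : 2*(j:ℝ)*(r:ℝ) + (q:ℝ) + 1 ≤ (x:ℝ) := by rw [← hx]; exact hzR.2.1
    have h2 : (x:ℝ) ≤ 2*(j:ℝ)*(r:ℝ) + (r:ℝ) + (q:ℝ) - 1 := by rw [← hx]; exact hzR.2.2
    have e1 : ((2*j - 2 : ℕ):ℝ) = 2*(j:ℝ) - 2 := by
      rw [Nat.cast_sub (by omega)]; push_cast; ring
    have e2 : ((2*j - 1 : ℕ):ℝ) = 2*(j:ℝ) - 1 := by
      rw [Nat.cast_sub (by omega)]; push_cast; ring
    have hp1 : (1:ℝ) ≤ (q:ℝ) := by exact_mod_cast hq.1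
    have hp2 : (q:ℝ) ≤ (r:ℝ) := by exact_mod_cast hq.2
    rcases le_or_gt x (2*(j:ℤ)*(r:ℤ) + (r:ℤ)) with h | h
    · have h' : (x:ℝ) ≤ 2*(j:ℝ)*(r:ℝ) + (r:ℝ) := by exact_mod_cast h
      have e := hH1uniq _ hl (by
        intro w hw
        have hw' : w.2 = (x:ℝ) := hw
        show _ ≤ w.2 ∧ w.2 ≤ _
        rw [e1, hw']
        constructor <;> linarith)
      rw [e] at hzl
      have : z.2 = 2*(j:ℝ)*(r:ℝ) + (q:ℝ) := hzl
      linarith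
    · have h' : 2*(j:ℝ)*(r:ℝ) + (r:ℝ) + 1 ≤ (x:ℝ) := by exact_mod_cast h
      have e := hH2uniq _ hl (by
        intro w hw
        have hw' : w.2 = (x:ℝ) := hw
        show _ ≤ w.2 ∧ w.2 ≤ _
        rw [e2, hw']
        constructor <;> linarith)
      rw [e] at hzl
      have : z.2 = 2*(j:ℝ)*(r:ℝ) + (r:ℝ) + (q:ℝ) := hzl
      linarith
  · obtain ⟨x, rfl⟩ := hV l hl
    have hx : z.1 = (x:ℝ) := hzl
    have h1 : 2*(i:ℝ)*(r:ℝ) + (p:ℝ) + 1 ≤ (x:ℝ) := by rw [← hx]; exact hzR.1.1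
    have h2 : (x:ℝ) ≤ 2*(i:ℝ)*(r:ℝ) + (r:ℝ) + (p:ℝ) - 1 := by rw [← hx]; exact hzR.1.2
    have e1 : ((2*i - 2 : ℕ):ℝ) = 2*(i:ℝ) - 2 := by
      rw [Nat.cast_sub (by omega)]; push_cast; ring
    have e2 : ((2*i - 1 : ℕ):ℝ) = 2*(i:ℝ) - 1 := by
      rw [Nat.cast_sub (by omega)]; push_cast; ring
    have hp1 : (1:ℝ) ≤ (p:ℝ) := by exact_mod_cast hp.1
    have hp2 : (p:ℝ) ≤ (r:ℝ) := by exact_mod_cast hp.2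
    rcases le_or_gt x (2*(i:ℤ)*(r:ℤ) + (r:ℤ)) with h | h
    · have h' : (x:ℝ) ≤ 2*(i:ℝ)*(r:ℝ) + (r:ℝ) := by exact_mod_cast h
      have e := hV1uniq _ hl (by
        intro w hw
        have hw' : w.1 = (x:ℝ) := hw
        show _ ≤ w.1 ∧ w.1 ≤ _
        rw [e1, hw']
        constructor <;> linarith)
      rw [e] at hzl
      have : z.1 = 2*(i:ℝ)*(r:ℝ) + (p:ℝ) := hzl
      linarith
    · have h' : 2*(i:ℝ)*(r:ℝ) + (r:ℝ) + 1 ≤ (x:ℝ) := by exact_mod_cast h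
      have e := hV2uniq _ hl (by
        intro w hw
        have hw' : w.1 = (x:ℝ) := hw
        show _ ≤ w.1 ∧ w.1 ≤ _
        rw [e2, hw']
        constructor <;> linarith)
      rw [e] at hzl
      have : z.1 = 2*(i:ℝ)*(r:ℝ) + (r:ℝ) + (p:ℝ) := hzl
      linarith
end
end
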